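/- Let N be a level-2 phylogenetic network on X with at least two blobs in which every leaf is contained in a blob, containing a pendant level-2 blob of the form (k, 0, 0, 0) with k ≥ 1 and chain (a_1, ..., a_k). Then for every x ∈ X \ {a_1, ..., a_k}, the multiset d^{N}(x, a_1) can be uniquely partitioned into four equal-sized multisets A, B, C, D with A − 3 = B − 4 = C − (k+2) = D − (k+3). Moreover, replacing the pendant blob by a single new leaf z yields a network N' on X' = (X \ {a_1, ..., a_k}) ∪ {z} whose multisets of distances satisfy d^{N'}(x,y) = d^{N}(x,y) for all x, y ∈ X' \ {z} and d^{N'}(x,z) = A − 3 for all x ∈ X' \ {z}. -/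

import Mathlib

open SimpleGraph

/-- A labelled graph: the raw data of a phylogenetic network on a label set `X`:
a finite vertex type, a simple graph on it, and a labelling map from `X` to vertices. -/
structure LabGraph (X : Type) where
  V : Type
  [fV : Fintype V]
  G : SimpleGraph V
  leaf : X → V

attribute [instance] LabGraph.fV

namespace LabGraph

variable {X : Type} [Fintype X] [DecidableEq X]

/-- The shortest distance `d_m(x,y)` between the leaves labelled `x` and `y`. -/
noncomputable def dm (N : LabGraph X) (x y : X) : ℕ :=
  N.G.dist (N.leaf x) (N.leaf y)

/-- The multiset `d(x,y)` of the lengths of all paths between the leaves `x` and `y`. -/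
noncomputable def dms (N : LabGraph X) (x y : X) : Multiset ℕ := by
  classical
  exact (Finset.univ : Finset (N.G.Path (N.leaf x) (N.leaf y))).val.map fun p => p.1.length

/-- The degree of a vertex. -/
noncomputable def degOf (N : LabGraph X) (v : N.V) : ℕ := (N.G.neighborSet v).ncard

/-- `N` is an (unweighted unrooted binary) phylogenetic network on `X`:
it is connected, the labelling is injective, and either it is the singleton graph
(when `|X| = 1`), or every leaf-labelled vertex has degree 1 and every other
vertex has degree 3 (so the degree-1 vertices are exactly the labelled leaves). -/
def IsNetwork (N : LabGraph X) : Prop :=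
  N.G.Connected ∧ Function.Injective N.leaf ∧
    ((Fintype.card X = 1 ∧ Fintype.card N.V = 1) ∨
      ((∀ x : X, N.degOf (N.leaf x) = 1) ∧
        ∀ v : N.V, v ∉ Set.range N.leaf → N.degOf v = 3))

/-- Two labelled graphs on `X` are isomorphic by a graph isomorphism fixing the leaf labels. -/
def IsomLabelled (N M : LabGraph X) : Prop :=
  ∃ φ : N.G ≃g M.G, ∀ x : X, φ (N.leaf x) = M.leaf x

/-- A subgraph is 2-connected (with at least three vertices): it is connected and
remains connected after deleting any one of its vertices. -/
def TwoConnSub (N : LabGraph X) (H : N.G.Subgraph) : Prop :=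
  3 ≤ H.verts.ncard ∧ H.coe.Connected ∧
    ∀ v ∈ H.verts, (H.deleteVerts {v}).coe.Connected

/-- A blob: a maximal 2-connected subgraph with at least three vertices. -/
def IsBlob (N : LabGraph X) (H : N.G.Subgraph) : Prop :=
  N.TwoConnSub H ∧ ∀ H' : N.G.Subgraph, N.TwoConnSub H' → H ≤ H' → H' = H

/-- Exactly `r` edges must be deleted from the (connected) subgraph `H` to obtain a
tree: `|E(H)| - |V(H)| + 1 = r`.  A level-1 blob has rank 1, a level-2 blob rank 2. -/
def BlobRank (N : LabGraph X) (H : N.G.Subgraph) (r : ℕ) : Prop :=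
  H.edgeSet.ncard + 1 = H.verts.ncard + r

/-- A network is level-`k` if at most `k` edges must be deleted from every blob
to obtain a tree. -/
def IsLevel (N : LabGraph X) (k : ℕ) : Prop :=
  ∀ H : N.G.Subgraph, N.IsBlob H → H.edgeSet.ncard + 1 ≤ H.verts.ncard + k

/-- A cut-edge: an edge whose deletion disconnects the graph. -/
def IsCutEdge (N : LabGraph X) (e : Sym2 N.V) : Prop :=
  e ∈ N.G.edgeSet ∧ ¬ (N.G.deleteEdges {e}).Connected

/-- A trivial (cut-)edge: one incident to a leaf. -/
def TrivialEdge (N : LabGraph X) (e : Sym2 N.V) : Prop :=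
  ∃ x : X, N.leaf x ∈ e

/-- An edge is incident to a blob if one of its endpoints is a vertex of the blob. -/
def EdgeIncBlob (N : LabGraph X) (e : Sym2 N.V) (H : N.G.Subgraph) : Prop :=
  ∃ v ∈ H.verts, v ∈ e

/-- A pendant blob: a blob with exactly one incident non-trivial cut-edge. -/
def IsPendantBlob (N : LabGraph X) (H : N.G.Subgraph) : Prop :=
  N.IsBlob H ∧
    ∃! e : Sym2 N.V, N.IsCutEdge e ∧ ¬ N.TrivialEdge e ∧ N.EdgeIncBlob e H

/-- A leaf is contained in a blob if its neighbour is a vertex of the blob. -/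
def LeafInBlob (N : LabGraph X) (x : X) (H : N.G.Subgraph) : Prop :=
  ∃ v : N.V, N.G.Adj (N.leaf x) v ∧ v ∈ H.verts

/-- `N` has at least two blobs. -/
def TwoBlobs (N : LabGraph X) : Prop :=
  ∃ H₁ H₂ : N.G.Subgraph, N.IsBlob H₁ ∧ N.IsBlob H₂ ∧ H₁ ≠ H₂

/-- Every leaf of `N` is contained in a blob. -/
def AllLeavesInBlobs (N : LabGraph X) : Prop :=
  ∀ x : X, ∃ H : N.G.Subgraph, N.IsBlob H ∧ N.LeafInBlob x H

/-- A chain: a `k`-tuple of leaves with consecutive shortest distances equal to 3. -/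
def IsChainT (N : LabGraph X) (k : ℕ) (a : Fin k → X) : Prop :=
  ∀ (i : ℕ) (h : i + 1 < k),
    N.dm (a ⟨i, Nat.lt_of_succ_lt h⟩) (a ⟨i + 1, h⟩) = 3

/-- A maximal chain: a chain whose leaf set is not properly contained in the leaf
set of another chain. -/
def IsMaxChainT (N : LabGraph X) (k : ℕ) (a : Fin k → X) : Prop :=
  N.IsChainT k a ∧ ∀ (l : ℕ) (b : Fin l → X), N.IsChainT l b →
    Set.range a ⊆ Set.range b → Set.range a = Set.range b

/-- The chain `a` is contained in the blob `H`: the edges between the neighbours of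
consecutive chain leaves are edges of `H`. -/
def ChainInBlob (N : LabGraph X) (k : ℕ) (a : Fin k → X) (H : N.G.Subgraph) : Prop :=
  ∀ (i : ℕ) (h : i + 1 < k) (p q : N.V),
    N.G.Adj (N.leaf (a ⟨i, Nat.lt_of_succ_lt h⟩)) p →
    N.G.Adj (N.leaf (a ⟨i + 1, h⟩)) q → H.Adj p q

/-- The multiset of natural numbers `A`, viewed in `ℤ`. -/
def toZ (A : Multiset ℕ) : Multiset ℤ := A.map (fun t => (t : ℤ))

/-- `A - n`: subtract `n` from every element of the multiset `A` (in `ℤ`). -/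
def zsub (A : Multiset ℕ) (n : ℤ) : Multiset ℤ := A.map (fun t => (t : ℤ) - n)

/-- The branch vertices of a blob `H`: its vertices of degree at least 3 in `H`. -/
def branchVerts (N : LabGraph X) (H : N.G.Subgraph) : Set N.V :=
  {w | w ∈ H.verts ∧ 3 ≤ (H.neighborSet w).ncard}

/-- `p` and `q` lie on a common side of the blob `H`: they are non-branch vertices of `H`
that are connected in `H` after deleting all branch vertices. -/
def SameSide (N : LabGraph X) (H : N.G.Subgraph) (p q : N.V) : Prop :=
  ∃ (hp : p ∈ (H.deleteVerts (N.branchVerts H)).verts)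
    (hq : q ∈ (H.deleteVerts (N.branchVerts H)).verts),
    (H.deleteVerts (N.branchVerts H)).coe.Reachable ⟨p, hp⟩ ⟨q, hq⟩

/-- `p` and `q` are separated by the vertex `u` within the sides of the blob `H`:
they are not connected in `H` after deleting all branch vertices and `u`. -/
def SepBy (N : LabGraph X) (H : N.G.Subgraph) (u p q : N.V) : Prop :=
  ¬ ∃ (hp : p ∈ (H.deleteVerts (N.branchVerts H ∪ {u})).verts)
      (hq : q ∈ (H.deleteVerts (N.branchVerts H ∪ {u})).verts),
      (H.deleteVerts (N.branchVerts H ∪ {u})).coe.Reachable ⟨p, hp⟩ ⟨q, hq⟩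

/-- The pendant level-2 blob `H` is of the form `(k, l, m, n)`, witnessed by the chains
`a, b, c, d` and the non-trivial cut-edge `s(u, w)` with `u ∈ H`: the chains `c` and `d`
lie on the same side of `H` as the cut-edge (separated by its endpoint `u`), the chains
`a` and `b` lie on two further (distinct) sides, and `a, b, c, d` are precisely the
(maximal) chains contained in `H`. A length-0 chain denotes a side without leaves. -/
def IsFormBlob (N : LabGraph X) (H : N.G.Subgraph) (u w : N.V) (k l m n : ℕ)
    (a : Fin k → X) (b : Fin l → X) (c : Fin m → X) (d : Fin n → X) : Prop :=
  N.IsPendantBlob H ∧ N.BlobRank H 2 ∧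
  N.IsCutEdge s(u, w) ∧ ¬ N.TrivialEdge s(u, w) ∧ u ∈ H.verts ∧ w ∉ H.verts ∧
  (0 < k → N.IsMaxChainT k a) ∧ (0 < l → N.IsMaxChainT l b) ∧
  (0 < m → N.IsMaxChainT m c) ∧ (0 < n → N.IsMaxChainT n d) ∧
  Function.Injective a ∧ Function.Injective b ∧
  Function.Injective c ∧ Function.Injective d ∧
  (Set.range a ∩ Set.range b = ∅) ∧ (Set.range a ∩ Set.range c = ∅) ∧
  (Set.range a ∩ Set.range d = ∅) ∧ (Set.range b ∩ Set.range c = ∅) ∧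
  (Set.range b ∩ Set.range d = ∅) ∧ (Set.range c ∩ Set.range d = ∅) ∧
  (∀ x : X, N.LeafInBlob x H ↔
    (x ∈ Set.range a ∨ x ∈ Set.range b ∨ x ∈ Set.range c ∨ x ∈ Set.range d)) ∧
  N.ChainInBlob k a H ∧ N.ChainInBlob l b H ∧ N.ChainInBlob m c H ∧ N.ChainInBlob n d H ∧
  (∀ (i : Fin k) (j : Fin l) (p q : N.V),
    N.G.Adj (N.leaf (a i)) p → N.G.Adj (N.leaf (b j)) q → ¬ N.SameSide H p q) ∧
  (∀ (i : Fin k) (p : N.V), N.G.Adj (N.leaf (a i)) p → ¬ N.SameSide H p u) ∧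
  (∀ (j : Fin l) (q : N.V), N.G.Adj (N.leaf (b j)) q → ¬ N.SameSide H q u) ∧
  (∀ (i : Fin m) (p : N.V), N.G.Adj (N.leaf (c i)) p → N.SameSide H p u) ∧
  (∀ (j : Fin n) (q : N.V), N.G.Adj (N.leaf (d j)) q → N.SameSide H q u) ∧
  (∀ (i : Fin m) (j : Fin n) (p q : N.V),
    N.G.Adj (N.leaf (c i)) p → N.G.Adj (N.leaf (d j)) q → N.SepBy H u p q)

/-- Replace a part `S` of the network (e.g. a pendant blob together with its pendant
leaves, labelled by `A`) by a single new leaf (the `Unit` summand) attached to `w`. -/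
noncomputable def blobReplace (N : LabGraph X) (A : Set X) (S : Set N.V) (w : N.V)
    (hmem : ∀ x : X, x ∉ A → N.leaf x ∉ S) (hw : w ∉ S) :
    LabGraph ({x : X // x ∉ A} ⊕ Unit) where
  V := {v : N.V // v ∉ S} ⊕ Unit
  fV := by classical exact inferInstance
  G := SimpleGraph.fromRel (fun w₁ w₂ =>
    (∃ v₁ v₂ : {v : N.V // v ∉ S}, w₁ = Sum.inl v₁ ∧ w₂ = Sum.inl v₂ ∧ N.G.Adj v₁.1 v₂.1) ∨
    (w₁ = Sum.inl ⟨w, hw⟩ ∧ w₂ = Sum.inr ()))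
  leaf := Sum.elim (fun x => Sum.inl ⟨N.leaf x.1, hmem x.1 x.2⟩) (fun _ => Sum.inr ())


set_option linter.unusedSectionVars false

section PathMultisets

/-- Multiset of the lengths of all paths. -/
noncomputable def plen {V : Type} [Fintype V] (G : SimpleGraph V) (x y : V) : Multiset ℕ := by
  classical
  exact ∑ p : G.Path x y, {p.1.length}

/-- Delete all edges incident to `T`. -/
def vdel {V : Type} (G : SimpleGraph V) (T : Set V) : SimpleGraph V where
  Adj a b := G.Adj a b ∧ a ∉ T ∧ b ∉ T
  symm := ⟨fun _ _ h => ⟨h.1.symm, h.2.2, h.2.1⟩⟩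
  loopless := ⟨fun a h => G.loopless.irrefl a h.1⟩

lemma vdel_le {V : Type} (G : SimpleGraph V) (T : Set V) : vdel G T ≤ G := fun _ _ h => h.1

lemma vdel_vdel {V : Type} (G : SimpleGraph V) (T T' : Set V) :
    vdel (vdel G T) T' = vdel G (T ∪ T') := by
  ext a b
  simp [vdel]
  tauto

lemma vdel_empty {V : Type} (G : SimpleGraph V) : vdel G ∅ = G := by
  ext a b
  simp [vdel]

lemma plen_comm {V : Type} [Fintype V] (G : SimpleGraph V) (x y : V) :
    plen G x y = plen G y x := by
  classical
  unfold plen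
  refine Fintype.sum_bijective (fun p : G.Path x y => p.reverse) ?_ _ _ ?_
  · refine Function.bijective_iff_has_inverse.2 ⟨fun p => p.reverse, ?_, ?_⟩ <;>
    · intro p
      apply Subtype.ext
      simp
  · intro p
    simp

lemma plen_embed {V W : Type} [Fintype V] [Fintype W] {G : SimpleGraph V} {K : SimpleGraph W}
    (f : G ↪g K) (x y : V)
    (h : ∀ p : K.Walk (f x) (f y), p.IsPath → ∀ v ∈ p.support, v ∈ Set.range f) :
    plen K (f x) (f y) = plen G x y := by
  classical
  have key : ∀ (a b : W) (p : K.Walk a b) (a' b' : V), f a' = a → f b' = b →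
      (∀ v ∈ p.support, v ∈ Set.range f) → ∃ q : G.Walk a' b', q.support.map f = p.support := by
    intro a b p
    induction p with
    | nil =>
      intro a' b' ha hb _
      have : a' = b' := f.injective (ha.trans hb.symm)
      subst this
      exact ⟨Walk.nil, by simp [ha]⟩
    | @cons a c b hac q ih =>
      intro a' b' ha hb hs
      obtain ⟨c', rfl⟩ := hs c (by simp)
      obtain ⟨r, hr⟩ := ih c' b' rfl hb (fun v hv => hs v (by simp [hv]))
      subst ha
      exact ⟨Walk.cons (f.map_adj_iff.1 hac) r, by simp [hr]⟩
  unfold plen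
  symm
  refine Fintype.sum_bijective (fun p : G.Path x y => p.mapEmbedding f) ⟨?_, ?_⟩ _ _ ?_
  · exact Path.mapEmbedding_injective f x y
  · intro p
    obtain ⟨q, hq⟩ := key _ _ p.1 x y rfl rfl (h p.1 p.2)
    have hqp : q.IsPath := by
      rw [Walk.isPath_def]
      have := p.2.support_nodup
      rw [← hq] at this
      exact this.of_map
    refine ⟨⟨q, hqp⟩, ?_⟩
    apply Subtype.ext
    apply Walk.ext_support
    simpa using hq
  · intro p
    simp

lemma mem_vdel_support {V : Type} {G : SimpleGraph V} {T : Set V} {a b : V}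
    (p : (vdel G T).Walk a b) (ha : a ∉ T) : ∀ v ∈ p.support, v ∉ T := by
  induction p with
  | nil => simpa using ha
  | cons h q ih =>
    intro v hv
    rw [Walk.support_cons, List.mem_cons] at hv
    rcases hv with rfl | hv
    · exact ha
    · exact ih h.2.2 v hv

open Classical in
lemma plen_rec {V : Type} [Fintype V] (G : SimpleGraph V)
    (y x : V) (hxy : y ≠ x) :
    plen G y x = ∑ n : V, if G.Adj y n then (plen (vdel G {y}) n x).map (· + 1) else 0 := by
  rw [← Finset.sum_filter]
  rw [← Finset.sum_subtype_of_mem (p := fun n => G.Adj y n) _ (by simp)]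
  have e : ∀ n : {n // G.Adj y n}, (plen (vdel G {y}) n x).map (· + 1) =
      ∑ p : (vdel G {y}).Path n x, {p.1.length + 1} := by
    intro n
    unfold plen
    rw [← Multiset.coe_mapAddMonoidHom, map_sum]
    refine Finset.sum_congr ?_ (fun p _ => by simp)
    congr!
  rw [Finset.sum_congr (s₂ := Finset.univ) (by ext a; simp [a.2]) (fun n _ => e n)]
  rw [← Fintype.sum_sigma']
  unfold plen
  symm
  refine Fintype.sum_bijective (fun s : (n : {n // G.Adj y n}) × (vdel G {y}).Path n x =>
    (⟨Walk.cons s.1.2 (s.2.1.mapLe (vdel_le G {y})), by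
      rw [Walk.cons_isPath_iff]
      refine ⟨(Walk.isPath_mapLe _).2 s.2.2, ?_⟩
      intro hy
      have h1 : y ∈ s.2.1.support := by simpa using hy
      exact mem_vdel_support s.2.1 (fun h => s.1.2.ne h.symm) y h1 rfl⟩ : G.Path y x)) ⟨?_, ?_⟩ _ _ ?_
  · rintro ⟨⟨n, hn⟩, p⟩ ⟨⟨m, hm⟩, q⟩ h
    have h1 := congrArg (fun r : G.Path y x => r.1.support) h
    simp only [Walk.support_cons, List.cons.injEq, true_and] at h1
    have h2 : p.1.support = q.1.support := by simpa using h1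
    have h3 : n = m := by
      have h4 := h2
      rw [← Walk.cons_tail_support p.1, ← Walk.cons_tail_support q.1] at h4
      exact (List.cons.inj h4).1
    subst h3
    congr 1
    apply Subtype.ext
    exact Walk.ext_support h2
  · rintro ⟨p, hp⟩
    cases p with
    | nil => exact absurd rfl hxy
    | @cons _ n _ h q =>
      rw [Walk.cons_isPath_iff] at hp
      have hq : ∀ e ∈ q.edges, e ∈ (vdel G {y}).edgeSet := by
        intro e he
        induction e with
        | h c d =>
          refine ⟨q.edges_subset_edgeSet he, ?_, ?_⟩
          · rintro rfl
            exact hp.2 (q.fst_mem_support_of_mem_edges he)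
          · rintro rfl
            exact hp.2 (q.snd_mem_support_of_mem_edges he)
      refine ⟨⟨⟨n, h⟩, ⟨q.transfer _ hq, hp.1.transfer hq⟩⟩, ?_⟩
      apply Subtype.ext
      apply Walk.ext_support
      simp
  · rintro ⟨n, p⟩
    simp

lemma plen_one {V : Type} [Fintype V] (G : SimpleGraph V) (y x n : V) (hxy : y ≠ x)
    (hn : G.Adj y n) (hd : ∀ m, G.Adj y m → m ≠ n → plen (vdel G {y}) m x = 0) :
    plen G y x = (plen (vdel G {y}) n x).map (· + 1) := by
  classical
  rw [plen_rec G y x hxy, Fintype.sum_eq_single n, if_pos hn]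
  intro m hm
  split_ifs with h
  · rw [hd m h hm]; rfl
  · rfl

lemma plen_two {V : Type} [Fintype V] (G : SimpleGraph V) (y x n n' : V) (hxy : y ≠ x)
    (hnn : n ≠ n') (hn : G.Adj y n) (hn' : G.Adj y n')
    (hd : ∀ m, G.Adj y m → m ≠ n → m ≠ n' → plen (vdel G {y}) m x = 0) :
    plen G y x = (plen (vdel G {y}) n x).map (· + 1) + (plen (vdel G {y}) n' x).map (· + 1) := by
  classical
  rw [plen_rec G y x hxy, Fintype.sum_eq_add n n' hnn, if_pos hn, if_pos hn']
  rintro m ⟨hm, hm'⟩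
  split_ifs with h
  · rw [hd m h hm hm']; rfl
  · rfl

lemma plen_dead {V : Type} [Fintype V] (G : SimpleGraph V) (K : Set V) (y x : V) (hy : y ∈ K)
    (hx : x ∉ K) (hK : ∀ a ∈ K, ∀ b, G.Adj a b → b ∈ K) : plen G y x = 0 := by
  classical
  unfold plen
  refine Finset.sum_eq_zero (fun p _ => ?_)
  obtain ⟨d, -, h1, h2⟩ := p.1.exists_boundary_dart K hy hx
  exact absurd (hK _ h1 _ d.adj) h2

lemma path_avoid {V : Type} (G : SimpleGraph V) (S : Set V) (u w : V)
    (hS : ∀ a ∈ S, ∀ b, G.Adj a b → b ∉ S → a = u ∧ b = w) {x y : V} (p : G.Walk x y)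
    (hp : p.IsPath) (hx : x ∉ S) (hy : y ∉ S) : ∀ v ∈ p.support, v ∉ S := by
  induction p with
  | nil => simpa using hx
  | @cons a n b h q ih =>
    rw [Walk.cons_isPath_iff] at hp
    intro v hv
    by_cases hn : n ∈ S
    · exfalso
      obtain ⟨d, hd, h1, h2⟩ := q.exists_boundary_dart S hn hy
      have e1 := hS _ h1 _ d.adj h2
      have e2 := hS _ hn _ h.symm hx
      apply hp.2
      rw [e2.2, ← e1.2]
      exact q.dart_snd_mem_support_of_mem_darts hd
    · rw [Walk.support_cons, List.mem_cons] at hv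
      rcases hv with rfl | hv
      · exact hx
      · exact ih hp.1 hn hy v hv

end PathMultisets

section ThetaPart

lemma vrec_one {V : Type} [Fintype V] (G : SimpleGraph V) (T : Set V) (y x n : V) (hxy : y ≠ x)
    (hy : y ∉ T) (hn : n ∉ T) (hyn : G.Adj y n)
    (hd : ∀ m, G.Adj y m → m ∉ T → m ≠ n → plen (vdel G (insert y T)) m x = 0) :
    plen (vdel G T) y x = (plen (vdel G (insert y T)) n x).map (· + 1) := by
  have e : vdel (vdel G T) {y} = vdel G (insert y T) := by
    rw [vdel_vdel, Set.union_singleton]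
  rw [plen_one (vdel G T) y x n hxy ⟨hyn, hy, hn⟩ ?_, e]
  intro m hm hmn
  rw [e]
  exact hd m hm.1 hm.2.2 hmn

lemma vrec_two {V : Type} [Fintype V] (G : SimpleGraph V) (T : Set V) (y x n n' : V) (hxy : y ≠ x)
    (hnn : n ≠ n') (hy : y ∉ T) (hn : n ∉ T) (hn' : n' ∉ T) (hyn : G.Adj y n) (hyn' : G.Adj y n')
    (hd : ∀ m, G.Adj y m → m ∉ T → m ≠ n → m ≠ n' → plen (vdel G (insert y T)) m x = 0) :
    plen (vdel G T) y x = (plen (vdel G (insert y T)) n x).map (· + 1) +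
      (plen (vdel G (insert y T)) n' x).map (· + 1) := by
  have e : vdel (vdel G T) {y} = vdel G (insert y T) := by
    rw [vdel_vdel, Set.union_singleton]
  rw [plen_two (vdel G T) y x n n' hxy hnn ⟨hyn, hy, hn⟩ ⟨hyn', hy, hn'⟩ ?_, e]
  intro m hm hmn hmn'
  rw [e]
  exact hd m hm.1 hm.2.2 hmn hmn'

lemma vdead {V : Type} [Fintype V] (G : SimpleGraph V) (T K : Set V) (y x : V) (hy : y ∈ K)
    (hx : x ∉ K) (hK : ∀ a ∈ K, ∀ b, G.Adj a b → a ∉ T → b ∉ T → b ∈ K) :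
    plen (vdel G T) y x = 0 :=
  plen_dead _ K y x hy hx (fun a ha b hab => hK a ha b hab.1 hab.2.1 hab.2.2)

/-- The inclusion of an induced subgraph. -/
def indEmb {V : Type} (G : SimpleGraph V) (S T : Set V) (hTS : T ⊆ S) :
    G.induce Sᶜ ↪g vdel G T where
  toFun := Subtype.val
  inj' := Subtype.val_injective
  map_rel_iff' := by
    intro a b
    simp only [vdel, Function.Embedding.coeFn_mk, comap_adj, Function.Embedding.subtype_apply]
    have h1 := fun h => a.2 (hTS h)
    have h2 := fun h => b.2 (hTS h)
    tauto

open Classical in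
lemma plen_ind {V : Type} [Fintype V] (G : SimpleGraph V) (S T : Set V) (hTS : T ⊆ S) (u w : V)
    (hS : ∀ a ∈ S, ∀ b, G.Adj a b → b ∉ S → a = u ∧ b = w)
    (x y : V) (hx : x ∉ S) (hy : y ∉ S) :
    plen (vdel G T) x y = plen (G.induce Sᶜ) ⟨x, hx⟩ ⟨y, hy⟩ := by
  refine plen_embed (indEmb G S T hTS) ⟨x, hx⟩ ⟨y, hy⟩ ?_
  intro p hp v hv
  have := path_avoid (vdel G T) S u w (fun a ha b hab hb => hS a ha b hab.1 hb) p hp hx hy v hv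
  exact ⟨⟨v, this⟩, rfl⟩

/-- Combinatorial description of a pendant theta blob with its leaves. -/
structure Theta {V : Type} (G : SimpleGraph V) (k : ℕ) (c l : ℕ → V) (u w : V) (S : Set V) :
    Prop where
  hk : 1 ≤ k
  cinj : ∀ i j, i ≤ k + 1 → j ≤ k + 1 → c i = c j → i = j
  linj : ∀ i j, 1 ≤ i → i ≤ k → 1 ≤ j → j ≤ k → l i = l j → i = j
  cl : ∀ i j, i ≤ k + 1 → 1 ≤ j → j ≤ k → c i ≠ l j
  cu : ∀ i, i ≤ k + 1 → c i ≠ u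
  lu : ∀ i, 1 ≤ i → i ≤ k → l i ≠ u
  nc0 : ∀ v, G.Adj (c 0) v ↔ (v = u ∨ v = c (k + 1) ∨ v = c 1)
  nck : ∀ v, G.Adj (c (k + 1)) v ↔ (v = u ∨ v = c 0 ∨ v = c k)
  nci : ∀ i, 1 ≤ i → i ≤ k → ∀ v, G.Adj (c i) v ↔ (v = l i ∨ v = c (i - 1) ∨ v = c (i + 1))
  nl : ∀ i, 1 ≤ i → i ≤ k → ∀ v, G.Adj (l i) v ↔ v = c i
  nu : ∀ v, G.Adj u v ↔ (v = w ∨ v = c 0 ∨ v = c (k + 1))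
  hS : ∀ v, v ∈ S ↔ (v = u ∨ (∃ i, i ≤ k + 1 ∧ v = c i) ∨ ∃ i, 1 ≤ i ∧ i ≤ k ∧ v = l i)
  hw : w ∉ S

namespace Theta

variable {V : Type} {G : SimpleGraph V} {k : ℕ} {c l : ℕ → V} {u w : V} {S : Set V}

lemma uS (h : Theta G k c l u w S) : u ∈ S := (h.hS u).2 (Or.inl rfl)
lemma cS (h : Theta G k c l u w S) (i : ℕ) (hi : i ≤ k + 1) : c i ∈ S :=
  (h.hS _).2 (Or.inr (Or.inl ⟨i, hi, rfl⟩))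
lemma lS (h : Theta G k c l u w S) (i : ℕ) (h1 : 1 ≤ i) (hi : i ≤ k) : l i ∈ S :=
  (h.hS _).2 (Or.inr (Or.inr ⟨i, h1, hi, rfl⟩))

lemma bdry (h : Theta G k c l u w S) : ∀ a ∈ S, ∀ b, G.Adj a b → b ∉ S → a = u ∧ b = w := by
  intro a ha b hab hb
  have hk := h.hk
  rcases (h.hS a).1 ha with rfl | ⟨i, hi, rfl⟩ | ⟨i, h1, hi, rfl⟩
  · rcases (h.nu b).1 hab with rfl | rfl | rfl
    · exact ⟨rfl, rfl⟩
    · exact absurd (h.cS _ (by omega)) hb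
    · exact absurd (h.cS _ (by omega)) hb
  · exfalso
    by_cases h0 : i = 0
    · subst h0
      rcases (h.nc0 b).1 hab with rfl | rfl | rfl
      · exact hb h.uS
      · exact hb (h.cS _ (by omega))
      · exact hb (h.cS _ (by omega))
    · by_cases h0' : i = k + 1
      · subst h0'
        rcases (h.nck b).1 hab with rfl | rfl | rfl
        · exact hb h.uS
        · exact hb (h.cS _ (by omega))
        · exact hb (h.cS _ (by omega))
      · rcases (h.nci i (by omega) (by omega) b).1 hab with rfl | rfl | rfl
        · exact hb (h.lS _ (by omega) (by omega))
        · exact hb (h.cS _ (by omega))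
        · exact hb (h.cS _ (by omega))
  · rw [h.nl i h1 hi] at hab
    subst hab
    exact absurd (h.cS _ (by omega)) hb

/-- From inside `S` without `u` one cannot get out. -/
lemma deadS [Fintype V] (h : Theta G k c l u w S) (T : Set V) (y x : V) (hy : y ∈ S) (hx : x ∉ S)
    (hu : u ∈ T) : plen (vdel G T) y x = 0 := by
  refine vdead G T S y x hy hx ?_
  intro a ha b hab haT _
  by_contra hb
  exact haT ((h.bdry a ha b hab hb).1 ▸ hu)

lemma stable [Fintype V] (h : Theta G k c l u w S) (T : Set V) (hT : T ⊆ S) (x : V)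
    (hx : x ∉ S) : plen (vdel G T) w x = plen (vdel G S) w x := by
  classical
  rw [plen_ind G S T hT u w h.bdry w x h.hw hx, plen_ind G S S le_rfl u w h.bdry w x h.hw hx]

/-- The common end part of all paths. -/
lemma ends [Fintype V] (h : Theta G k c l u w S) (T : Set V) (hT : T ⊆ S) (x : V) (hx : x ∉ S)
    (s t s' t' : V) (hs : s ∈ S) (ht : t ∈ S) (hst : s ≠ t) (hsu : s ≠ u) (htu : t ≠ u)
    (hNs : ∀ v, G.Adj s v ↔ (v = u ∨ v = t ∨ v = s'))
    (hNt : ∀ v, G.Adj t v ↔ (v = u ∨ v = s ∨ v = t'))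
    (hNu : ∀ v, G.Adj u v ↔ (v = w ∨ v = s ∨ v = t))
    (hsT : s ∉ T) (htT : t ∉ T) (huT : u ∉ T) (hs'T : s' ∈ T)
    (ht' : t' ∉ T → plen (vdel G (insert t (insert s T))) t' x = 0) :
    plen (vdel G T) s x = (plen (vdel G S) w x).map (· + 2) +
      (plen (vdel G S) w x).map (· + 3) := by
  have hne : ∀ v ∈ S, v ≠ x := by
    rintro v hv rfl
    exact hx hv
  have hwS : ∀ v ∈ S, w ≠ v := by
    rintro v hv rfl
    exact h.hw hv
  have hwT : w ∉ T := fun hh => h.hw (hT hh)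
  have sub1 : insert s T ⊆ S := Set.insert_subset hs hT
  have sub2 : insert t (insert s T) ⊆ S := Set.insert_subset ht sub1
  have e1 : plen (vdel G (insert s T)) u x = (plen (vdel G S) w x).map (· + 1) := by
    rw [vrec_one G (insert s T) u x w (hne u h.uS) (by simp [hsu.symm, huT])
      (by simp [hwT, hwS s hs]) ((hNu w).2 (Or.inl rfl)) ?_]
    · rw [h.stable _ (Set.insert_subset h.uS sub1) x hx]
    · intro m hm hmT hmw
      rcases (hNu m).1 hm with rfl | rfl | rfl
      · exact absurd rfl hmw
      · simp at hmT
      · exact h.deadS _ _ _ ht hx (by simp)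
  have e2 : plen (vdel G (insert t (insert s T))) u x = (plen (vdel G S) w x).map (· + 1) := by
    rw [vrec_one G (insert t (insert s T)) u x w (hne u h.uS) (by simp [hsu.symm, htu.symm, huT])
      (by simp [hwT, hwS s hs, hwS t ht]) ((hNu w).2 (Or.inl rfl)) ?_]
    · rw [h.stable _ (Set.insert_subset h.uS sub2) x hx]
    · intro m hm hmT hmw
      rcases (hNu m).1 hm with rfl | rfl | rfl
      · exact absurd rfl hmw
      · simp at hmT
      · simp at hmT
  have e3 : plen (vdel G (insert s T)) t x = (plen (vdel G S) w x).map (· + 2) := by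
    rw [vrec_one G (insert s T) t x u (hne t ht) (by simp [hst.symm, htT])
      (by simp [hsu.symm, huT]) ((hNt u).2 (Or.inl rfl)) ?_]
    · rw [e2, Multiset.map_map]
      rfl
    · intro m hm hmT hmw
      rcases (hNt m).1 hm with rfl | rfl | rfl
      · exact absurd rfl hmw
      · simp at hmT
      · exact ht' (fun hh => hmT (by simp [hh]))
  rw [vrec_two G T s x u t (hne s hs) htu.symm hsT huT htT ((hNs u).2 (Or.inl rfl))
    ((hNs t).2 (Or.inr (Or.inl rfl))) ?_]
  · rw [e1, e3, Multiset.map_map, Multiset.map_map]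
    rfl
  · intro m hm hmT h1 h2
    rcases (hNs m).1 hm with rfl | rfl | rfl
    · exact absurd rfl h1
    · exact absurd rfl h2
    · exact absurd hs'T hmT

/-- Deleted vertices when walking along the chain. -/
def TT (c l : ℕ → V) (j : ℕ) : Set V := {v | v = l 1 ∨ ∃ i, 1 ≤ i ∧ i < j ∧ v = c i}

lemma TT_sub (h : Theta G k c l u w S) (j : ℕ) (hj : j ≤ k + 1) : TT c l j ⊆ S := by
  rintro v (rfl | ⟨i, h1, h2, rfl⟩)
  · exact h.lS 1 le_rfl h.hk
  · exact h.cS i (by omega)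

lemma TT_c (h : Theta G k c l u w S) (j i : ℕ) (hj : j ≤ k + 1) (hi : i ≤ k + 1) :
    c i ∈ TT c l j ↔ (1 ≤ i ∧ i < j) := by
  constructor
  · rintro (hh | ⟨m, h1, h2, h3⟩)
    · exact absurd hh (h.cl i 1 hi le_rfl h.hk)
    · have := h.cinj i m hi (by omega) h3
      omega
  · rintro ⟨h1, h2⟩
    exact Or.inr ⟨i, h1, h2, rfl⟩

lemma TT_u (h : Theta G k c l u w S) (j : ℕ) (hj : j ≤ k + 1) : u ∉ TT c l j := by
  rintro (hh | ⟨m, h1, h2, h3⟩)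
  · exact h.lu 1 le_rfl h.hk hh.symm
  · exact h.cu m (by omega) h3.symm

lemma TT_succ (j : ℕ) (hj : 1 ≤ j) : insert (c j) (TT c l j) = TT c l (j + 1) := by
  ext v
  simp only [TT, Set.mem_insert_iff, Set.mem_ofPred_eq]
  constructor
  · rintro (rfl | rfl | ⟨i, h1, h2, rfl⟩)
    · exact Or.inr ⟨j, hj, by omega, rfl⟩
    · exact Or.inl rfl
    · exact Or.inr ⟨i, h1, by omega, rfl⟩
  · rintro (rfl | ⟨i, h1, h2, rfl⟩)
    · exact Or.inr (Or.inl rfl)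
    · by_cases hij : i = j
      · subst hij
        exact Or.inl rfl
      · exact Or.inr (Or.inr ⟨i, h1, by omega, rfl⟩)

/-- Walking along the chain. -/
lemma along [Fintype V] (h : Theta G k c l u w S) (x : V) (hx : x ∉ S) (r : ℕ) :
    ∀ j, 2 ≤ j → j + r = k + 1 → plen (vdel G (TT c l j)) (c j) x =
      (plen (vdel G (TT c l (k + 1))) (c (k + 1)) x).map (· + r) := by
  induction r with
  | zero =>
    intro j _ hj
    have : j = k + 1 := by omega
    subst this
    simp
  | succ r ih =>
    intro j h2 hj
    rw [vrec_one G (TT c l j) (c j) x (c (j + 1)) ?_ ?_ ?_ ?_ ?_]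
    · rw [TT_succ j (by omega), ih (j + 1) (by omega) (by omega), Multiset.map_map]
      congr 1
    · rintro rfl
      exact hx (h.cS _ (by omega))
    · rw [h.TT_c _ _ (by omega) (by omega)]
      omega
    · rw [h.TT_c _ _ (by omega) (by omega)]
      omega
    · exact (h.nci j (by omega) (by omega) _).2 (Or.inr (Or.inr rfl))
    · intro m hm hmT hmn
      rcases (h.nci j (by omega) (by omega) m).1 hm with rfl | rfl | rfl
      · refine vdead G _ {l j} _ x rfl ?_ ?_
        · rintro rfl
          exact hx (h.lS _ (by omega) (by omega))
        · rintro a rfl b hab _ hb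
          rw [h.nl j (by omega) (by omega)] at hab
          subst hab
          simp at hb
      · exfalso
        apply hmT
        rw [h.TT_c _ _ (by omega) (by omega)]
        omega
      · exact absurd rfl hmn

lemma total [Fintype V] (h : Theta G k c l u w S) (x : V) (hx : x ∉ S) :
    plen G (l 1) x = (plen (vdel G S) w x).map (· + 4) + (plen (vdel G S) w x).map (· + 5) +
      (plen (vdel G S) w x).map (· + (k + 3)) + (plen (vdel G S) w x).map (· + (k + 4)) := by
  have hk := h.hk
  have T1 : insert (l 1) ∅ = TT c l 1 := by
    ext v
    simp only [TT, Set.mem_insert_iff, Set.mem_ofPred_eq, Set.mem_empty_iff_false]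
    constructor
    · rintro (h | h)
      · exact Or.inl h
      · exact h.elim
    · rintro (h | ⟨i, h1, h2, _⟩)
      · exact Or.inl h
      · omega
  have e0 : plen G (l 1) x = (plen (vdel G (TT c l 1)) (c 1) x).map (· + 1) := by
    conv_lhs => rw [← vdel_empty G]
    rw [vrec_one G ∅ (l 1) x (c 1) ?_ (by simp) (by simp) ((h.nl 1 le_rfl hk _).2 rfl) ?_, T1]
    · rintro rfl
      exact hx (h.lS 1 le_rfl hk)
    · intro m hm _ hmn
      exact absurd ((h.nl 1 le_rfl hk _).1 hm) hmn
  have e1 : plen (vdel G (TT c l 1)) (c 1) x = (plen (vdel G (TT c l 2)) (c 0) x).map (· + 1) +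
      (plen (vdel G (TT c l 2)) (c 2) x).map (· + 1) := by
    rw [vrec_two G (TT c l 1) (c 1) x (c 0) (c 2) ?_ ?_ ?_ ?_ ?_ ?_ ?_ ?_, TT_succ 1 le_rfl]
    · rintro rfl
      exact hx (h.cS 1 (by omega))
    · intro hh
      have := h.cinj 0 2 (by omega) (by omega) hh
      omega
    · rw [h.TT_c _ _ (by omega) (by omega)]; omega
    · rw [h.TT_c _ _ (by omega) (by omega)]; omega
    · rw [h.TT_c _ _ (by omega) (by omega)]; omega
    · exact (h.nci 1 le_rfl hk _).2 (Or.inr (Or.inl rfl))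
    · exact (h.nci 1 le_rfl hk _).2 (Or.inr (Or.inr rfl))
    · intro m hm hmT h1 h2
      rcases (h.nci 1 le_rfl hk m).1 hm with rfl | rfl | rfl
      · exact absurd (Or.inl rfl) hmT
      · exact absurd rfl h1
      · exact absurd rfl h2
  have hne : c 0 ≠ c (k + 1) := by
    intro hh
    have := h.cinj 0 (k + 1) (by omega) (by omega) hh
    omega
  have e2 : plen (vdel G (TT c l 2)) (c 0) x = (plen (vdel G S) w x).map (· + 2) +
      (plen (vdel G S) w x).map (· + 3) := by
    refine h.ends _ (h.TT_sub 2 (by omega)) x hx (c 0) (c (k + 1)) (c 1) (c k)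
      (h.cS _ (by omega)) (h.cS _ (by omega)) hne (h.cu _ (by omega)) (h.cu _ (by omega))
      h.nc0 h.nck h.nu ?_ ?_ (h.TT_u 2 (by omega)) ?_ ?_
    · rw [h.TT_c _ _ (by omega) (by omega)]; omega
    · rw [h.TT_c _ _ (by omega) (by omega)]; omega
    · rw [h.TT_c _ _ (by omega) (by omega)]; omega
    · intro hck
      rw [h.TT_c _ _ (by omega) (by omega)] at hck
      refine vdead G _ {v | ∃ i, 2 ≤ i ∧ i ≤ k ∧ (v = c i ∨ v = l i)} _ x
        ⟨k, by omega, le_rfl, Or.inl rfl⟩ ?_ ?_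
      · rintro ⟨i, h1, h2, rfl | rfl⟩
        · exact hx (h.cS _ (by omega))
        · exact hx (h.lS _ (by omega) (by omega))
      · rintro a ⟨i, h1, h2, rfl | rfl⟩ b hab _ hb
        · rcases (h.nci i (by omega) (by omega) b).1 hab with rfl | rfl | rfl
          · exact ⟨i, h1, h2, Or.inr rfl⟩
          · by_cases hi : i = 2
            · subst hi
              exfalso
              apply hb
              refine Or.inr (Or.inr ?_)
              rw [h.TT_c _ _ (by omega) (by omega)]; omega
            · exact ⟨i - 1, by omega, by omega, Or.inl rfl⟩
          · by_cases hi : i = k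
            · subst hi
              exfalso
              exact hb (Or.inl rfl)
            · exact ⟨i + 1, by omega, by omega, Or.inl rfl⟩
        · rw [h.nl i (by omega) (by omega)] at hab
          exact ⟨i, h1, h2, Or.inl hab⟩
  have e3 : plen (vdel G (TT c l (k + 1))) (c (k + 1)) x = (plen (vdel G S) w x).map (· + 2) +
      (plen (vdel G S) w x).map (· + 3) := by
    refine h.ends _ (h.TT_sub _ (by omega)) x hx (c (k + 1)) (c 0) (c k) (c 1)
      (h.cS _ (by omega)) (h.cS _ (by omega)) hne.symm (h.cu _ (by omega)) (h.cu _ (by omega))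
      h.nck h.nc0 (fun v => (h.nu v).trans (by tauto)) ?_ ?_ (h.TT_u _ (by omega)) ?_ ?_
    · rw [h.TT_c _ _ (by omega) (by omega)]; omega
    · rw [h.TT_c _ _ (by omega) (by omega)]; omega
    · rw [h.TT_c _ _ (by omega) (by omega)]; omega
    · intro hck
      rw [h.TT_c _ _ (by omega) (by omega)] at hck
      omega
  rw [e0, e1, h.along x hx (k - 1) 2 le_rfl (by omega), e2, e3]
  simp only [Multiset.map_add, Multiset.map_map, Function.comp_def]
  have a1 : ∀ t : ℕ, t + 2 + (k - 1) + 1 + 1 = t + (k + 3) := by intro t; omega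
  have a2 : ∀ t : ℕ, t + 3 + (k - 1) + 1 + 1 = t + (k + 4) := by intro t; omega
  rw [funext a1, funext a2, ← add_assoc]

end Theta

end ThetaPart

lemma cycle_del_base {V : Type} {G : SimpleGraph V} {x : V} (C : G.Walk x x) (hC : C.IsCycle) :
    (C.toSubgraph.deleteVerts {x}).Connected := by
  cases C with
  | nil => exact absurd hC (by simp)
  | @cons _ y _ h p =>
    rw [Walk.cons_isCycle_iff] at hC
    have hnil : ¬ p.Nil := fun hn => h.ne hn.eq.symm
    have hsupp := p.support_dropLast hnil
    have hcat := Walk.support_dropLast_concat hnil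
    have hnd := hC.1.support_nodup
    rw [← hcat] at hnd
    have hx : x ∉ p.dropLast.support := by
      intro hx
      rw [List.nodup_append] at hnd
      exact hnd.2.2 x hx x (by simp) rfl
    refine Subgraph.Connected.mono' (H := p.dropLast.toSubgraph) ?_ ?_
      (Walk.toSubgraph_connected _)
    · intro a b hab
      have ha : a ∈ p.dropLast.support := by
        rw [← Walk.mem_verts_toSubgraph]; exact hab.fst_mem
      have hb : b ∈ p.dropLast.support := by
        rw [← Walk.mem_verts_toSubgraph]; exact hab.snd_mem
      have hab' : (Walk.cons h p).toSubgraph.Adj a b := by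
        rw [Walk.adj_toSubgraph_iff_mem_edges] at hab ⊢
        rw [Walk.edges_cons]
        refine List.mem_cons_of_mem _ ?_
        exact (Walk.IsSubwalk.edges_subset (p.isSubwalk_rfl.dropLast)) hab
      rw [Subgraph.deleteVerts_adj]
      refine ⟨hab'.fst_mem, ?_, hab'.snd_mem, ?_, hab'⟩
      · rintro rfl; exact hx ha
      · rintro rfl; exact hx hb
    · ext a
      rw [Walk.mem_verts_toSubgraph, Subgraph.deleteVerts_verts, Set.mem_sdiff,
        Walk.mem_verts_toSubgraph, Walk.support_cons, ← hcat]
      simp only [List.mem_cons, List.mem_append, Set.mem_singleton_iff,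
        List.not_mem_nil, or_false]
      constructor
      · intro ha
        exact ⟨by tauto, by rintro rfl; exact hx ha⟩
      · tauto

lemma cycle_del {V : Type} {G : SimpleGraph V} {x : V} (C : G.Walk x x) (hC : C.IsCycle) (v : V) :
    (C.toSubgraph.deleteVerts {v}).Connected := by
  classical
  by_cases hv : v ∈ C.support
  · have := cycle_del_base (C.rotate v hv) (hC.rotate hv)
    rwa [Walk.toSubgraph_rotate] at this
  · refine Subgraph.Connected.mono' (H := C.toSubgraph) ?_ ?_ (Walk.toSubgraph_connected _)
    · intro a b hab
      rw [Subgraph.deleteVerts_adj]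
      refine ⟨hab.fst_mem, ?_, hab.snd_mem, ?_, hab⟩
      · rintro rfl; exact hv (by rw [← Walk.mem_verts_toSubgraph]; exact hab.fst_mem)
      · rintro rfl; exact hv (by rw [← Walk.mem_verts_toSubgraph]; exact hab.snd_mem)
    · rw [Subgraph.deleteVerts_verts, Set.sdiff_singleton_eq_self]
      rwa [Walk.mem_verts_toSubgraph]

lemma TwoConnSub.two_nbrs {N : LabGraph X} {H : N.G.Subgraph} (h : N.TwoConnSub H) {v : N.V}
    (hv : v ∈ H.verts) : ∃ y z, y ≠ z ∧ H.Adj v y ∧ H.Adj v z := by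
  obtain ⟨h3, hc, hd⟩ := h
  have hfin : H.verts.Finite := Set.toFinite _
  have nt : H.verts.Nontrivial := by
    rw [← Set.one_lt_ncard_iff_nontrivial]; omega
  have := nt.coe_sort
  obtain ⟨y, hy⟩ := Subgraph.Preconnected.exists_adj_of_nontrivial ⟨hc.preconnected⟩ ⟨v, hv⟩
  have hyH : y ∈ H.verts := hy.snd_mem
  have nt2 : (H.deleteVerts {y}).verts.Nontrivial := by
    rw [← Set.one_lt_ncard_iff_nontrivial, Subgraph.deleteVerts_verts,
      Set.ncard_sdiff_singleton_of_mem hyH]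
    omega
  have := nt2.coe_sort
  have hvy : v ∈ (H.deleteVerts {y}).verts := by
    rw [Subgraph.deleteVerts_verts]
    exact ⟨hv, fun hh => hy.ne hh⟩
  obtain ⟨z, hz⟩ := Subgraph.Preconnected.exists_adj_of_nontrivial ⟨(hd y hyH).preconnected⟩
    ⟨v, hvy⟩
  rw [Subgraph.deleteVerts_adj] at hz
  exact ⟨y, z, fun hh => hz.2.2.2.1 hh.symm, hy, hz.2.2.2.2⟩

lemma TwoConnSub.sup {N : LabGraph X} {H : N.G.Subgraph} (h : N.TwoConnSub H)
    {K : N.G.Subgraph} (hK : K.Connected) (hKd : ∀ v, (K.deleteVerts {v}).Connected)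
    {a b : N.V} (hab : a ≠ b) (haH : a ∈ H.verts) (hbH : b ∈ H.verts) (haK : a ∈ K.verts)
    (hbK : b ∈ K.verts) : N.TwoConnSub (H ⊔ K) := by
  obtain ⟨h3, hc, hd⟩ := h
  refine ⟨?_, ?_, ?_⟩
  · refine h3.trans (Set.ncard_le_ncard ?_ (Set.toFinite _))
    exact Set.subset_union_left
  · exact (Subgraph.connected_sup ⟨hc.preconnected⟩ hK.preconnected ⟨a, haH, haK⟩).coe
  · intro v _
    have hHd : (H.deleteVerts {v}).Connected := by
      by_cases hv : v ∈ H.verts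
      · exact ⟨hd v hv⟩
      · have : H.deleteVerts {v} = H := by
          rw [← Subgraph.deleteVerts_inter_verts_left_eq]
          rw [Set.inter_singleton_eq_empty.2 hv, Subgraph.deleteVerts_empty]
        rw [this]
        exact ⟨hc⟩
    have hne : ((H.deleteVerts {v}) ⊓ (K.deleteVerts {v})).verts.Nonempty := by
      by_cases hav : a = v
      · exact ⟨b, ⟨hbH, fun hh => hab (hav.trans hh.symm)⟩, ⟨hbK, fun hh => hab (hav.trans hh.symm)⟩⟩
      · exact ⟨a, ⟨haH, hav⟩, ⟨haK, hav⟩⟩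
    have := Subgraph.connected_sup hHd.preconnected (hKd v).preconnected hne
    refine (Subgraph.Connected.mono' ?_ ?_ this).coe
    · rintro c d (hh | hh)
      · rw [Subgraph.deleteVerts_adj] at hh ⊢
        exact ⟨Or.inl hh.1, hh.2.1, Or.inl hh.2.2.1, hh.2.2.2.1, Or.inl hh.2.2.2.2⟩
      · rw [Subgraph.deleteVerts_adj] at hh ⊢
        exact ⟨Or.inr hh.1, hh.2.1, Or.inr hh.2.2.1, hh.2.2.2.1, Or.inr hh.2.2.2.2⟩
    · simp only [Subgraph.verts_sup, Subgraph.deleteVerts_verts, Set.union_sdiff_distrib]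

lemma blob_deg {N : LabGraph X} (hN : N.IsNetwork) {H : N.G.Subgraph} (hH : N.TwoConnSub H)
    {v : N.V} (hv : v ∈ H.verts) : v ∉ Set.range N.leaf ∧ N.degOf v = 3 := by
  obtain ⟨hc, hinj, h | ⟨h1, h3⟩⟩ := hN
  · exfalso
    have := hH.1
    have h2 : H.verts.ncard ≤ Fintype.card N.V := by
      rw [← Nat.card_eq_fintype_card]
      exact Set.ncard_le_card _
    omega
  · have : v ∉ Set.range N.leaf := by
      rintro ⟨x, rfl⟩
      obtain ⟨y, z, hyz, hy, hz⟩ := hH.two_nbrs hv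
      have := h1 x
      unfold degOf at this
      rw [Set.ncard_eq_one] at this
      obtain ⟨q, hq⟩ := this
      have e1 : y ∈ N.G.neighborSet (N.leaf x) := hy.adj_sub
      have e2 : z ∈ N.G.neighborSet (N.leaf x) := hz.adj_sub
      rw [hq] at e1 e2
      exact hyz (e1.trans e2.symm)
    exact ⟨this, h3 v this⟩

lemma three_set {V : Type} {s : Set V} (hs : s.ncard = 3) {a b c : V} (ha : a ∈ s) (hb : b ∈ s)
    (hc : c ∈ s) (hab : a ≠ b) (hac : a ≠ c) (hbc : b ≠ c) (v : V) :
    v ∈ s ↔ (v = a ∨ v = b ∨ v = c) := by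
  have hfin : s.Finite := Set.finite_of_ncard_ne_zero (by omega)
  have : ({a, b, c} : Set V) = s := by
    refine Set.eq_of_subset_of_ncard_le ?_ ?_ hfin
    · rintro x (rfl | rfl | rfl) <;> assumption
    · rw [hs, Set.ncard_eq_three.2 ⟨a, b, c, hab, hac, hbc, rfl⟩]
  rw [← this]
  simp

lemma ext_cut {N : LabGraph X} (hN : N.IsNetwork) {H : N.G.Subgraph} (hH : N.IsBlob H)
    {v y : N.V} (hv : v ∈ H.verts) (hvy : N.G.Adj v y) (hnot : ¬ H.Adj v y) :
    N.IsCutEdge s(v, y) := by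
  classical
  refine ⟨hvy, fun hcon => ?_⟩
  have hnb : ¬ N.G.IsBridge s(v, y) := by
    rw [isBridge_iff, not_not]
    exact hcon.preconnected v y
  rw [isBridge_iff_forall_cycle_notMem (by exact hvy)] at hnb
  push Not at hnb
  obtain ⟨x, C, hC, hmem⟩ := hnb
  have hadj : C.toSubgraph.Adj v y := by
    rw [Walk.adj_toSubgraph_iff_mem_edges]; exact hmem
  have hvs : v ∈ C.support := by rw [← Walk.mem_verts_toSubgraph]; exact hadj.fst_mem
  have h2 := hC.ncard_neighborSet_toSubgraph_eq_two hvs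
  obtain ⟨y', hy', hne⟩ := Set.exists_ne_of_one_lt_ncard (by rw [h2]; norm_num) y
  have hy'a : C.toSubgraph.Adj v y' := hy'
  obtain ⟨p, q, hpq, hp, hq⟩ := hH.1.two_nbrs hv
  have h3 := (blob_deg hN hH.1 hv).2
  have key := three_set h3 (a := y) (b := p) (c := q) hvy hp.adj_sub hq.adj_sub
    (by rintro rfl; exact hnot hp) (by rintro rfl; exact hnot hq) hpq y'
  have hy'H : y' ∈ H.verts := by
    rcases key.1 hy'a.adj_sub with rfl | rfl | rfl
    · exact absurd rfl hne
    · exact hp.snd_mem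
    · exact hq.snd_mem
  have h2c := hH.1.sup (K := C.toSubgraph) (Walk.toSubgraph_connected C) (cycle_del C hC)
    hy'a.ne hv hy'H hy'a.fst_mem hy'a.snd_mem
  have := hH.2 _ h2c le_sup_left
  apply hnot
  rw [← this]
  exact Or.inr hadj

lemma four_false {V : Type} {s : Set V} (hs : s.ncard = 3) {a b c d : V} (ha : a ∈ s) (hb : b ∈ s)
    (hc : c ∈ s) (hd : d ∈ s) (hab : a ≠ b) (hac : a ≠ c) (had : a ≠ d) (hbc : b ≠ c)
    (hbd : b ≠ d) (hcd : c ≠ d) : False := by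
  rcases (three_set hs ha hb hc hab hac hbc d).1 hd with h | h | h
  · exact had h.symm
  · exact hbd h.symm
  · exact hcd h.symm

lemma third_nbr {V : Type} {s : Set V} (hs : s.ncard = 3) (a b : V) :
    ∃ c ∈ s, c ≠ a ∧ c ≠ b := by
  by_contra hcon
  push Not at hcon
  have hsub : s ⊆ {a, b} := by
    intro c hc
    by_cases h : c = a
    · exact Or.inl h
    · exact Or.inr (hcon c hc h)
  have h1 := Set.ncard_le_ncard hsub (Set.toFinite _)
  have h2 := Set.ncard_insert_le a {b}
  rw [Set.ncard_singleton] at h2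
  omega

/-- Build the theta structure from local data, oriented version. -/
lemma theta_oriented {V : Type} {G : SimpleGraph V} (K : Set V) (k : ℕ) (hk : 1 ≤ k)
    (P L : ℕ → V) (u w s t : V)
    (hdeg : ∀ v ∈ K, (G.neighborSet v).ncard = 3)
    (hLK : ∀ i, i < k → L i ∉ K) (hwK : w ∉ K) (hwL : ∀ i, i < k → w ≠ L i)
    (hL : ∀ i, i < k → ∀ v, G.Adj (L i) v ↔ v = P i)
    (hLinj : ∀ i j, i < k → j < k → L i = L j → i = j)
    (hPK : ∀ i, i < k → P i ∈ K) (hPinj : ∀ i j, i < k → j < k → P i = P j → i = j)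
    (hPP : ∀ i, i + 1 < k → G.Adj (P i) (P (i + 1)))
    (huK : u ∈ K) (huw : G.Adj u w) (hsK : s ∈ K) (htK : t ∈ K)
    (hst : s ≠ t) (hsu : s ≠ u) (htu : t ≠ u) (hPs : ∀ i, i < k → P i ≠ s)
    (hPt : ∀ i, i < k → P i ≠ t) (hPu : ∀ i, i < k → P i ≠ u)
    (hall : ∀ v ∈ K, v = s ∨ v = t ∨ v = u ∨ ∃ i, i < k ∧ v = P i)
    (hsN : ∀ v, G.Adj s v → v ∈ K)
    (hus : G.Adj u s) (hut : G.Adj u t) (hs0 : G.Adj s (P 0)) (htk : G.Adj t (P (k - 1))) :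
    ∃ c l : ℕ → V, Theta G k c l u w (K ∪ {v | ∃ i, i < k ∧ v = L i}) ∧ l 1 = L 0 := by
  have hPL : ∀ i j, i < k → j < k → P i ≠ L j := by
    intro i j hi hj h
    exact hLK j hj (h ▸ hPK i hi)
  have hadjPL : ∀ i, i < k → G.Adj (P i) (L i) := fun i hi => ((hL i hi _).2 rfl).symm
  have hPne : ∀ i j, i < k → j < k → i ≠ j → P i ≠ P j := by
    intro i j hi hj hij h
    exact hij (hPinj i j hi hj h)
  have hsL : ∀ i, i < k → s ≠ L i := by
    intro i hi h
    exact hLK i hi (h ▸ hsK)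
  have htL : ∀ i, i < k → t ≠ L i := by
    intro i hi h
    exact hLK i hi (h ▸ htK)
  -- s and t are adjacent
  have hstA : G.Adj s t := by
    by_contra hn
    obtain ⟨v, hv, hv1, hv2⟩ := third_nbr (hdeg s hsK) u (P 0)
    have hv' : G.Adj s v := hv
    rcases hall v (hsN v hv') with rfl | rfl | rfl | ⟨i, hi, rfl⟩
    · exact hv'.ne rfl
    · exact hn hv'
    · exact hv1 rfl
    · have hi0 : i ≠ 0 := by
        rintro rfl
        exact hv2 rfl
      have hprev : G.Adj (P i) (P (i - 1)) := by
        have := (hPP (i - 1) (by omega)).symm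
        rwa [Nat.sub_add_cancel (by omega)] at this
      by_cases hik : i = k - 1
      · subst hik
        exact four_false (hdeg _ (hPK _ hi)) (a := s) (b := t) (c := P (k - 1 - 1))
          (d := L (k - 1)) hv'.symm htk.symm hprev (hadjPL _ hi) hst (hPs _ (by omega)).symm
          (hsL _ hi) (hPt _ (by omega)).symm (htL _ hi) (hPL _ _ (by omega) hi)
      · exact four_false (hdeg _ (hPK _ hi)) (a := s) (b := P (i + 1)) (c := P (i - 1))
          (d := L i) hv'.symm (hPP i (by omega)) hprev (hadjPL _ hi) (hPs _ (by omega)).symm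
          (hPs _ (by omega)).symm
          (hsL _ hi) (hPne _ _ (by omega) (by omega) (by omega)) (hPL _ _ (by omega) hi)
          (hPL _ _ (by omega) hi)
  let c : ℕ → V := fun i => if i = 0 then s else if i = k + 1 then t else P (i - 1)
  have c0 : c 0 = s := by simp [c]
  have ck1 : c (k + 1) = t := by simp [c]
  have ci : ∀ i, 1 ≤ i → i ≤ k → c i = P (i - 1) := by
    intro i h1 h2
    have e1 : i ≠ 0 := by omega
    have e2 : i ≠ k + 1 := by omega
    simp [c, e1, e2]
  have cK : ∀ i, i ≤ k + 1 → c i ∈ K := by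
    intro i hi
    by_cases h0 : i = 0
    · rw [h0, c0]; exact hsK
    by_cases h1 : i = k + 1
    · rw [h1, ck1]; exact htK
    rw [ci i (by omega) (by omega)]
    exact hPK _ (by omega)
  refine ⟨c, fun i => L (i - 1), ⟨hk, ?_, ?_, ?_, ?_, ?_, ?_, ?_, ?_, ?_, ?_, ?_, ?_⟩, rfl⟩
  · intro i j hi hj h
    rcases Nat.eq_zero_or_pos i with rfl | hi0 <;> rcases Nat.eq_zero_or_pos j with rfl | hj0
    · rfl
    · exfalso
      rw [c0] at h
      by_cases h1 : j = k + 1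
      · rw [h1, ck1] at h; exact hst h
      · rw [ci j hj0 (by omega)] at h; exact hPs _ (by omega) h.symm
    · exfalso
      rw [c0] at h
      by_cases h1 : i = k + 1
      · rw [h1, ck1] at h; exact hst h.symm
      · rw [ci i hi0 (by omega)] at h; exact hPs _ (by omega) h
    · by_cases h1 : i = k + 1 <;> by_cases h2 : j = k + 1
      · omega
      · exfalso
        rw [h1, ck1, ci j hj0 (by omega)] at h
        exact hPt _ (by omega) h.symm
      · exfalso
        rw [h2, ck1, ci i hi0 (by omega)] at h
        exact hPt _ (by omega) h
      · rw [ci i hi0 (by omega), ci j hj0 (by omega)] at h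
        have := hPinj _ _ (by omega) (by omega) h
        omega
  · intro i j hi hi' hj hj' h
    have := hLinj _ _ (by omega) (by omega) h
    omega
  · intro i j hi hj hj' h
    exact hLK (j - 1) (by omega) (h ▸ cK i hi)
  · intro i hi h
    by_cases h0 : i = 0
    · rw [h0, c0] at h; exact hsu h
    by_cases h1 : i = k + 1
    · rw [h1, ck1] at h; exact htu h
    rw [ci i (by omega) (by omega)] at h
    exact hPu _ (by omega) h
  · intro i hi hi' h
    exact hLK (i - 1) (by omega) (h ▸ huK)
  · intro v
    rw [c0, ck1, ci 1 le_rfl hk]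
    exact three_set (hdeg s hsK) (a := u) (b := t) (c := P 0) hus.symm hstA hs0 htu.symm
      (hPu 0 hk).symm (hPt 0 hk).symm v
  · intro v
    rw [c0, ck1, ci k hk le_rfl]
    exact three_set (hdeg t htK) (a := u) (b := s) (c := P (k - 1)) hut.symm hstA.symm htk hsu.symm
      (hPu _ (by omega)).symm (hPs _ (by omega)).symm v
  · intro i hi hi' v
    have hik : i - 1 < k := by omega
    rw [ci i hi hi']
    have hA : G.Adj (P (i - 1)) (c (i - 1)) := by
      by_cases h1 : i = 1
      · subst h1
        rw [show 1 - 1 = 0 from rfl, c0]; exact hs0.symm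
      · rw [ci (i - 1) (by omega) (by omega)]
        have := (hPP (i - 1 - 1) (by omega)).symm
        rwa [Nat.sub_add_cancel (by omega)] at this
    have hB : G.Adj (P (i - 1)) (c (i + 1)) := by
      by_cases h1 : i = k
      · subst h1
        rw [ck1]; exact htk.symm
      · rw [ci (i + 1) (by omega) (by omega)]
        have := hPP (i - 1) (by omega)
        rwa [Nat.sub_add_cancel (by omega)] at this
    refine three_set (hdeg _ (hPK _ hik)) (a := L (i - 1)) (b := c (i - 1)) (c := c (i + 1))
      (hadjPL _ hik) hA hB ?_ ?_ ?_ v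
    · intro h
      exact hLK _ hik (h ▸ cK (i - 1) (by omega))
    · intro h
      exact hLK _ hik (h ▸ cK (i + 1) (by omega))
    · by_cases h0 : i - 1 = 0
      · rw [h0, c0]
        by_cases h1 : i = k
        · rw [h1, ck1]; exact hst
        · rw [ci (i + 1) (by omega) (by omega)]
          exact (hPs _ (by omega)).symm
      · rw [ci (i - 1) (by omega) (by omega)]
        by_cases h1 : i = k
        · rw [h1, ck1]; exact hPt _ (by omega)
        · rw [ci (i + 1) (by omega) (by omega)]
          exact hPne _ _ (by omega) (by omega) (by omega)
  · intro i hi hi' v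
    rw [ci i hi hi']
    exact hL _ (by omega) v
  · intro v
    rw [c0, ck1]
    exact three_set (hdeg u huK) (a := w) (b := s) (c := t) huw hus hut
      (fun h => hwK (h ▸ hsK)) (fun h => hwK (h ▸ htK)) hst v
  · intro v
    constructor
    · rintro (hv | ⟨i, hi, rfl⟩)
      · rcases hall v hv with rfl | rfl | rfl | ⟨i, hi, rfl⟩
        · exact Or.inr (Or.inl ⟨0, by omega, c0.symm⟩)
        · exact Or.inr (Or.inl ⟨k + 1, by omega, ck1.symm⟩)
        · exact Or.inl rfl
        · refine Or.inr (Or.inl ⟨i + 1, by omega, ?_⟩)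
          rw [ci _ (by omega) (by omega), Nat.add_sub_cancel]
      · exact Or.inr (Or.inr ⟨i + 1, by omega, by omega, by simp⟩)
    · rintro (rfl | ⟨i, hi, rfl⟩ | ⟨i, h1, hi, rfl⟩)
      · exact Or.inl huK
      · exact Or.inl (cK i hi)
      · exact Or.inr ⟨i - 1, by omega, rfl⟩
  · rintro (h | ⟨i, hi, h⟩)
    · exact hwK h
    · exact hwL i hi h

/-- Build the theta structure from local data. -/
lemma theta_build {V : Type} {G : SimpleGraph V} (K : Set V) (k : ℕ) (hk : 1 ≤ k)
    (P L : ℕ → V) (u w s t : V)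
    (hdeg : ∀ v ∈ K, (G.neighborSet v).ncard = 3)
    (hLK : ∀ i, i < k → L i ∉ K) (hwK : w ∉ K) (hwL : ∀ i, i < k → w ≠ L i)
    (hL : ∀ i, i < k → ∀ v, G.Adj (L i) v ↔ v = P i)
    (hLinj : ∀ i j, i < k → j < k → L i = L j → i = j)
    (hPK : ∀ i, i < k → P i ∈ K) (hPinj : ∀ i j, i < k → j < k → P i = P j → i = j)
    (hPP : ∀ i, i + 1 < k → G.Adj (P i) (P (i + 1)))
    (huK : u ∈ K) (huw : G.Adj u w) (hsK : s ∈ K) (htK : t ∈ K)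
    (hst : s ≠ t) (hsu : s ≠ u) (htu : t ≠ u) (hPs : ∀ i, i < k → P i ≠ s)
    (hPt : ∀ i, i < k → P i ≠ t) (hPu : ∀ i, i < k → P i ≠ u)
    (hall : ∀ v ∈ K, v = s ∨ v = t ∨ v = u ∨ ∃ i, i < k ∧ v = P i)
    (hsN : ∀ v, G.Adj s v → v ∈ K) (htN : ∀ v, G.Adj t v → v ∈ K)
    (hus : G.Adj u s) (hut : G.Adj u t) :
    ∃ c l : ℕ → V, Theta G k c l u w (K ∪ {v | ∃ i, i < k ∧ v = L i}) ∧ l 1 = L 0 := by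
  have hPL : ∀ i j, i < k → j < k → P i ≠ L j := by
    intro i j hi hj h
    exact hLK j hj (h ▸ hPK i hi)
  have hadjPL : ∀ i, i < k → G.Adj (P i) (L i) := fun i hi => ((hL i hi _).2 rfl).symm
  have hPne : ∀ i j, i < k → j < k → i ≠ j → P i ≠ P j := by
    intro i j hi hj hij h
    exact hij (hPinj i j hi hj h)
  have hKL : ∀ z ∈ K, ∀ i, i < k → z ≠ L i := by
    intro z hz i hi h
    exact hLK i hi (h ▸ hz)
  have hprev : ∀ i, i < k → i ≠ 0 → G.Adj (P i) (P (i - 1)) := by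
    intro i hi hi0
    have := (hPP (i - 1) (by omega)).symm
    rwa [Nat.sub_add_cancel (by omega)] at this
  have hend : ∀ z ∈ K, (∀ i, i < k → P i ≠ z) → ∀ i, i < k → G.Adj z (P i) →
      i = 0 ∨ i = k - 1 := by
    intro z hz hPz i hi hzi
    by_contra hcon
    push Not at hcon
    exact four_false (hdeg _ (hPK _ hi)) (a := z) (b := P (i + 1)) (c := P (i - 1))
          (d := L i) hzi.symm (hPP i (by omega)) (hprev i hi hcon.1) (hadjPL _ hi)
          (hPz _ (by omega)).symm (hPz _ (by omega)).symm
          (hKL z hz _ hi) (hPne _ _ (by omega) (by omega) (by omega)) (hPL _ _ (by omega) hi)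
          (hPL _ _ (by omega) hi)
  obtain ⟨v, hv, hv1, hv2⟩ := third_nbr (hdeg s hsK) u t
  obtain ⟨v', hv', hv1', hv2'⟩ := third_nbr (hdeg t htK) u s
  have hvA : G.Adj s v := hv
  have hvA' : G.Adj t v' := hv'
  obtain ⟨i, hi, rfl⟩ : ∃ i, i < k ∧ v = P i := by
    rcases hall v (hsN v hv) with rfl | rfl | rfl | h
    · exact absurd rfl hvA.ne
    · exact absurd rfl hv2
    · exact absurd rfl hv1
    · exact h
  obtain ⟨j, hj, rfl⟩ : ∃ i, i < k ∧ v' = P i := by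
    rcases hall v' (htN v' hv') with rfl | rfl | rfl | h
    · exact absurd rfl hv2'
    · exact absurd rfl hvA'.ne
    · exact absurd rfl hv1'
    · exact h
  have hi' := hend s hsK hPs i hi hvA
  have hj' := hend t htK hPt j hj hvA'
  have hij : k = 1 ∨ i ≠ j := by
    by_contra hcon
    push Not at hcon
    obtain ⟨hk1, rfl⟩ := hcon
    by_cases h0 : i = 0
    · subst h0
      exact four_false (hdeg _ (hPK _ hi)) (a := s) (b := t) (c := P (0 + 1)) (d := L 0)
        hvA.symm hvA'.symm (hPP 0 (by omega)) (hadjPL _ hi) hst (hPs _ (by omega)).symm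
        (hKL s hsK _ hi) (hPt _ (by omega)).symm (hKL t htK _ hi) (hPL _ _ (by omega) hi)
    · exact four_false (hdeg _ (hPK _ hi)) (a := s) (b := t) (c := P (i - 1)) (d := L i)
        hvA.symm hvA'.symm (hprev i hi h0) (hadjPL _ hi) hst (hPs _ (by omega)).symm
        (hKL s hsK _ hi) (hPt _ (by omega)).symm (hKL t htK _ hi) (hPL _ _ (by omega) hi)
  have hcase : (i = 0 ∧ j = k - 1) ∨ (i = k - 1 ∧ j = 0) := by omega
  rcases hcase with ⟨rfl, rfl⟩ | ⟨rfl, rfl⟩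
  · exact theta_oriented K k hk P L u w s t hdeg hLK hwK hwL hL hLinj hPK hPinj hPP huK huw hsK htK
      hst hsu htu hPs hPt hPu hall hsN hus hut hvA hvA'
  · exact theta_oriented K k hk P L u w t s hdeg hLK hwK hwL hL hLinj hPK hPinj hPP huK huw htK hsK
      hst.symm htu hsu hPt hPs hPu (fun v hv => by have := hall v hv; tauto) htN hut hus hvA' hvA

open Classical in
/-- A rank-two subgraph with all degrees two or three has exactly two vertices of degree three. -/
lemma two_branch {V : Type} [Fintype V] {G : SimpleGraph V} (H : G.Subgraph)
    (hr : H.edgeSet.ncard + 1 = H.verts.ncard + 2)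
    (hd : ∀ v ∈ H.verts, (H.neighborSet v).ncard = 2 ∨ (H.neighborSet v).ncard = 3) :
    ∃ s t, s ≠ t ∧ ∀ v, (v ∈ H.verts ∧ (H.neighborSet v).ncard = 3) ↔ (v = s ∨ v = t) := by
  have hsum := H.spanningCoe.sum_degrees_eq_twice_card_edges
  have hE : H.spanningCoe.edgeFinset.card = H.edgeSet.ncard := by
    rw [← Set.ncard_coe_finset, coe_edgeFinset, Subgraph.edgeSet_spanningCoe]
  have hD : ∀ v, H.spanningCoe.degree v = (H.neighborSet v).ncard := by
    intro v
    rw [← card_neighborFinset_eq_degree, ← Set.ncard_coe_finset, coe_neighborFinset]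
    rfl
  have hV : H.verts.ncard = ∑ v : V, if v ∈ H.verts then 1 else 0 := by
    rw [Finset.sum_boole, ← Set.ncard_coe_finset]
    simp
  have hB : {v | v ∈ H.verts ∧ (H.neighborSet v).ncard = 3}.ncard =
      ∑ v : V, if v ∈ H.verts ∧ (H.neighborSet v).ncard = 3 then 1 else 0 := by
    rw [Finset.sum_boole, ← Set.ncard_coe_finset]
    simp
  have hsplit : ∑ v, H.spanningCoe.degree v =
      2 * (∑ v : V, if v ∈ H.verts then 1 else 0) +
      ∑ v : V, if v ∈ H.verts ∧ (H.neighborSet v).ncard = 3 then 1 else 0 := by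
    rw [Finset.mul_sum, ← Finset.sum_add_distrib]
    refine Finset.sum_congr rfl (fun v _ => ?_)
    rw [hD]
    by_cases hv : v ∈ H.verts
    · rcases hd v hv with h | h <;> simp [hv, h]
    · have : H.neighborSet v = ∅ := by
        ext y
        simp only [Subgraph.mem_neighborSet, Set.mem_empty_iff_false, iff_false]
        exact fun h => hv h.fst_mem
      simp [hv, this]
  rw [← hV, ← hB, hsum, hE] at hsplit
  have h2 : {v | v ∈ H.verts ∧ (H.neighborSet v).ncard = 3}.ncard = 2 := by omega
  rw [Set.ncard_eq_two] at h2
  obtain ⟨s, t, hst, h⟩ := h2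
  refine ⟨s, t, hst, fun v => ?_⟩
  have : v ∈ {v | v ∈ H.verts ∧ (H.neighborSet v).ncard = 3} ↔ v ∈ ({s, t} : Set V) := by rw [h]
  simpa using this

/-- A pendant blob of form `(k,0,0,0)` has the expected theta structure. -/
lemma theta_of_form {N : LabGraph X} (hN : N.IsNetwork) {k : ℕ} (hk : 1 ≤ k) {a : Fin k → X}
    {H : N.G.Subgraph} {u w : N.V}
    (hform : N.IsFormBlob H u w k 0 0 0 a Fin.elim0 Fin.elim0 Fin.elim0) :
    ∃ c l : ℕ → N.V, Theta N.G k c l u w (H.verts ∪ N.leaf '' Set.range a) ∧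
      l 1 = N.leaf (a ⟨0, hk⟩) := by
  classical
  obtain ⟨hpend, hrank, hcut, hnontriv, huH, hwH, -, -, -, -, hainj, -, -, -, -, -, -, -, -, -,
    hleafin, hchain, -, -, -, -, hside, -, -, -, -⟩ := hform
  obtain ⟨hblob, hex⟩ := hpend
  have h2c := hblob.1
  have hin : ∀ x, N.LeafInBlob x H ↔ x ∈ Set.range a := by
    intro x
    rw [hleafin x]
    constructor
    · rintro (h | ⟨i, -⟩ | ⟨i, -⟩ | ⟨i, -⟩)
      · exact h
      all_goals exact i.elim0
    · exact Or.inl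
  have hLeafK : ∀ x, N.leaf x ∉ H.verts := fun x hx => (blob_deg hN h2c hx).1 ⟨x, rfl⟩
  have hdeg : ∀ v ∈ H.verts, (N.G.neighborSet v).ncard = 3 := fun v hv => (blob_deg hN h2c hv).2
  have hinj := hN.2.1
  have hdeg1 : ∀ x, (N.G.neighborSet (N.leaf x)).ncard = 1 := by
    obtain ⟨-, -, h | h⟩ := hN
    · exfalso
      have := h2c.1
      have h2 : H.verts.ncard ≤ Fintype.card N.V := by
        rw [← Nat.card_eq_fintype_card]
        exact Set.ncard_le_card _
      omega
    · exact h.1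
  have hpar : ∀ x, ∃ p, ∀ v, N.G.Adj (N.leaf x) v ↔ v = p := by
    intro x
    obtain ⟨p, hp⟩ := Set.ncard_eq_one.1 (hdeg1 x)
    refine ⟨p, fun v => ?_⟩
    have : v ∈ N.G.neighborSet (N.leaf x) ↔ v ∈ ({p} : Set N.V) := by rw [hp]
    simpa using this
  choose par hpar using hpar
  have hparK : ∀ x ∈ Set.range a, par x ∈ H.verts := by
    intro x hx
    obtain ⟨v, hv, hvH⟩ := (hin x).2 hx
    rw [← (hpar x v).1 hv]; exact hvH
  -- external edges
  have hext : ∀ v ∈ H.verts, ∀ y, N.G.Adj v y → ¬ H.Adj v y →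
      (v = u ∧ y = w) ∨ ∃ x ∈ Set.range a, y = N.leaf x ∧ v = par x := by
    intro v hv y hvy hnot
    have hc := ext_cut hN hblob hv hvy hnot
    by_cases ht : N.TrivialEdge s(v, y)
    · right
      obtain ⟨x, hx⟩ := ht
      rcases Sym2.mem_iff.1 hx with h | h
      · exact absurd (h ▸ hv) (hLeafK x)
      · have hp : v = par x := (hpar x v).1 (h ▸ hvy.symm)
        refine ⟨x, (hin x).1 ⟨v, h ▸ hvy.symm, hv⟩, h.symm, hp⟩
    · left
      have := hex.unique ⟨hc, ht, v, hv, Sym2.mem_mk_left _ _⟩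
        ⟨hcut, hnontriv, u, huH, Sym2.mem_mk_left _ _⟩
      rcases Sym2.eq_iff.1 this with h | h
      · exact h
      · exact absurd (h.1 ▸ hv) hwH
  have hsubN : ∀ v, H.neighborSet v ⊆ N.G.neighborSet v := fun v y hy => H.adj_sub hy
  have hd23 : ∀ v ∈ H.verts, (H.neighborSet v).ncard = 2 ∨ (H.neighborSet v).ncard = 3 := by
    intro v hv
    obtain ⟨y, z, hyz, hy, hz⟩ := h2c.two_nbrs hv
    have h1 := Set.ncard_le_ncard (hsubN v) (Set.toFinite _)
    have h2 : ({y, z} : Set N.V).ncard ≤ (H.neighborSet v).ncard := by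
      refine Set.ncard_le_ncard ?_ (Set.toFinite _)
      rintro p (rfl | rfl)
      · exact hy
      · exact hz
    rw [Set.ncard_pair hyz] at h2
    rw [hdeg v hv] at h1
    omega
  have hd3 : ∀ v ∈ H.verts, (H.neighborSet v).ncard = 3 → ∀ y, N.G.Adj v y → H.Adj v y := by
    intro v hv h3 y hy
    have : H.neighborSet v = N.G.neighborSet v :=
      Set.eq_of_subset_of_ncard_le (hsubN v) (by rw [h3, hdeg v hv]) (Set.toFinite _)
    have hm : y ∈ N.G.neighborSet v := hy
    rw [← this] at hm
    exact hm
  have hd2 : ∀ v ∈ H.verts, (H.neighborSet v).ncard = 2 → ∃ y, N.G.Adj v y ∧ ¬ H.Adj v y := by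
    intro v hv h2
    by_contra hcon
    push Not at hcon
    have h1 := Set.ncard_le_ncard (s := N.G.neighborSet v) (t := H.neighborSet v)
      (fun y hy => hcon y hy) (Set.toFinite _)
    rw [hdeg v hv] at h1
    omega
  have huw : N.G.Adj u w := hcut.1
  have huw' : ¬ H.Adj u w := fun h => hwH h.snd_mem
  have hwl : ∀ x, w ≠ N.leaf x := by
    intro x h
    exact hnontriv ⟨x, h ▸ Sym2.mem_mk_right _ _⟩
  obtain ⟨s, t, hst, hbr⟩ := two_branch H hrank hd23
  have hs := (hbr s).2 (Or.inl rfl)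
  have ht := (hbr t).2 (Or.inr rfl)
  have hnb : ∀ v ∈ H.verts, ∀ y, N.G.Adj v y → y ∉ H.verts → v ≠ s ∧ v ≠ t := by
    intro v hv y hvy hy
    have : ¬ (v ∈ H.verts ∧ (H.neighborSet v).ncard = 3) := fun h =>
      hy (hd3 v hv h.2 y hvy).snd_mem
    rw [hbr] at this
    push Not at this
    exact this
  have hparl : ∀ x, N.G.Adj (par x) (N.leaf x) := fun x => ((hpar x _).2 rfl).symm
  have hPnb : ∀ x ∈ Set.range a, par x ≠ s ∧ par x ≠ t := fun x hx =>
    hnb _ (hparK x hx) _ (hparl x) (hLeafK x)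
  have hunb := hnb u huH w huw hwH
  have hone : ∀ v ∈ H.verts, ∀ y y', N.G.Adj v y → N.G.Adj v y' → y ∉ H.verts → y' ∉ H.verts →
      y = y' := by
    intro v hv y y' hy hy' hyH hyH'
    by_contra hne
    obtain ⟨p, q, hpq, hp, hq⟩ := h2c.two_nbrs hv
    have hp' := hp.snd_mem
    have hq' := hq.snd_mem
    exact four_false (hdeg v hv) (a := p) (b := q) (c := y) (d := y') (H.adj_sub hp)
      (H.adj_sub hq) hy hy' hpq (fun h => hyH (h ▸ hp')) (fun h => hyH' (h ▸ hp'))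
      (fun h => hyH (h ▸ hq')) (fun h => hyH' (h ▸ hq')) hne
  have hparinj : ∀ x ∈ Set.range a, ∀ y ∈ Set.range a, par x = par y → x = y := by
    intro x hx y hy h
    refine hinj (hone (par x) (hparK x hx) _ _ (hparl x) (h ▸ hparl y) (hLeafK _) (hLeafK _))
  have hparu : ∀ x ∈ Set.range a, par x ≠ u := by
    intro x hx h
    exact hwl x (hone u huH _ _ huw (h ▸ hparl x) hwH (hLeafK x))
  have hnotbr : ∀ v ∈ H.verts, v ≠ s → v ≠ t → v ∉ N.branchVerts H := by
    intro v hv h1 h2 hb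
    have h3 : (H.neighborSet v).ncard = 3 := by
      have := hd23 v hv
      have := hb.2
      omega
    rcases (hbr v).1 ⟨hv, h3⟩ with h | h
    · exact h1 h
    · exact h2 h
  have hnadj : ∀ x ∈ Set.range a, ¬ H.Adj (par x) u := by
    rintro x ⟨i, rfl⟩ hadj
    have hb1 := hnotbr _ hadj.fst_mem (hPnb _ ⟨i, rfl⟩).1 (hPnb _ ⟨i, rfl⟩).2
    have hb2 := hnotbr u huH hunb.1 hunb.2
    refine hside i _ (hparl _).symm ⟨?_, ?_, ?_⟩
    · exact ⟨hadj.fst_mem, hb1⟩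
    · exact ⟨huH, hb2⟩
    · refine Adj.reachable ?_
      rw [Subgraph.coe_adj, Subgraph.deleteVerts_adj]
      exact ⟨hadj.fst_mem, hb1, huH, hb2, hadj⟩
  have hall : ∀ v ∈ H.verts, v = s ∨ v = t ∨ v = u ∨ ∃ x ∈ Set.range a, v = par x := by
    intro v hv
    rcases hd23 v hv with h | h
    · obtain ⟨y, hy, hy'⟩ := hd2 v hv h
      rcases hext v hv y hy hy' with h | ⟨x, hx, -, h⟩
      · exact Or.inr (Or.inr (Or.inl h.1))
      · exact Or.inr (Or.inr (Or.inr ⟨x, hx, h⟩))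
    · rcases (hbr v).1 ⟨hv, h⟩ with h | h
      · exact Or.inl h
      · exact Or.inr (Or.inl h)
  have hunbr : ∀ y, H.Adj u y → y = s ∨ y = t := by
    intro y hy
    rcases hall y hy.snd_mem with h | h | h | ⟨x, hx, h⟩
    · exact Or.inl h
    · exact Or.inr h
    · exact absurd h.symm hy.ne
    · exact absurd (h ▸ hy.symm) (hnadj x hx)
  have hust : N.G.Adj u s ∧ N.G.Adj u t := by
    obtain ⟨p, q, hpq, hp, hq⟩ := h2c.two_nbrs huH
    rcases hunbr p hp with rfl | rfl <;> rcases hunbr q hq with rfl | rfl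
    · exact absurd rfl hpq
    · exact ⟨H.adj_sub hp, H.adj_sub hq⟩
    · exact ⟨H.adj_sub hq, H.adj_sub hp⟩
    · exact absurd rfl hpq
  let a' : ℕ → X := fun i => if h : i < k then a ⟨i, h⟩ else a ⟨0, hk⟩
  have ha' : ∀ i (h : i < k), a' i = a ⟨i, h⟩ := fun i h => dif_pos h
  have har : ∀ i, a' i ∈ Set.range a := by
    intro i
    by_cases h : i < k
    · rw [ha' i h]; exact ⟨_, rfl⟩
    · exact ⟨⟨0, hk⟩, by simp [a', h]⟩
  have ha'inj : ∀ i j, i < k → j < k → a' i = a' j → i = j := by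
    intro i j hi hj h
    rw [ha' i hi, ha' j hj] at h
    simpa using hainj h
  obtain ⟨c, l, hT, hl⟩ := theta_build (G := N.G) H.verts k hk (fun i => par (a' i))
    (fun i => N.leaf (a' i)) u w s t hdeg (fun i _ => hLeafK _) hwH (fun i _ => hwl _)
    (fun i _ v => hpar _ v) (fun i j hi hj h => ha'inj i j hi hj (hinj h))
    (fun i _ => hparK _ (har i))
    (fun i j hi hj h => ha'inj i j hi hj (hparinj _ (har i) _ (har j) h))
    (by
      intro i hi
      refine H.adj_sub (hchain i hi _ _ ?_ ?_)
      · rw [← ha' i (by omega)]; exact (hparl _).symm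
      · rw [← ha' (i + 1) hi]; exact (hparl _).symm)
    huH huw hs.1 ht.1 hst hunb.1.symm hunb.2.symm (fun i _ => (hPnb _ (har i)).1)
    (fun i _ => (hPnb _ (har i)).2) (fun i _ => hparu _ (har i))
    (by
      intro v hv
      rcases hall v hv with h | h | h | ⟨x, ⟨⟨i, hi⟩, rfl⟩, h⟩
      · exact Or.inl h
      · exact Or.inr (Or.inl h)
      · exact Or.inr (Or.inr (Or.inl h))
      · exact Or.inr (Or.inr (Or.inr ⟨i, hi, by rw [ha' i hi]; exact h⟩)))
    (fun v hv => (hd3 s hs.1 hs.2 v hv).snd_mem) (fun v hv => (hd3 t ht.1 ht.2 v hv).snd_mem)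
    hust.1 hust.2
  have hset : {v | ∃ i, i < k ∧ v = N.leaf (a' i)} = N.leaf '' Set.range a := by
    ext v
    constructor
    · rintro ⟨i, -, rfl⟩
      exact ⟨_, har i, rfl⟩
    · rintro ⟨x, ⟨⟨i, hi⟩, rfl⟩, rfl⟩
      exact ⟨i, hi, by rw [ha' i hi]⟩
  rw [hset] at hT
  refine ⟨c, l, hT, ?_⟩
  rw [hl]
  exact congrArg N.leaf (ha' 0 (by omega))

lemma count_shift (A : Multiset ℕ) (d n : ℕ) :
    (A.map (· + d)).count n = if d ≤ n then A.count (n - d) else 0 := by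
  split_ifs with h
  · obtain ⟨m, rfl⟩ := Nat.exists_eq_add_of_le' h
    rw [Nat.add_sub_cancel]
    exact Multiset.count_map_eq_count' (· + d) A (add_left_injective d) m
  · rw [Multiset.count_eq_zero, Multiset.mem_map]
    rintro ⟨m, -, hm⟩
    omega

lemma shift_unique {k : ℕ} (A B : Multiset ℕ)
    (h : A + A.map (· + 1) + A.map (· + (k - 1)) + A.map (· + k)
      = B + B.map (· + 1) + B.map (· + (k - 1)) + B.map (· + k)) (hk : 1 ≤ k) : A = B := by
  ext n
  induction n using Nat.strong_induction_on with
  | _ n ih =>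
    have h1 := congrArg (Multiset.count n) h
    simp only [Multiset.count_add, count_shift] at h1
    have e1 : (if 1 ≤ n then A.count (n - 1) else 0) = if 1 ≤ n then B.count (n - 1) else 0 := by
      split_ifs
      · exact ih _ (by omega)
      · rfl
    have e2 : (if k ≤ n then A.count (n - k) else 0) = if k ≤ n then B.count (n - k) else 0 := by
      split_ifs
      · exact ih _ (by omega)
      · rfl
    rw [e1, e2] at h1
    by_cases hk1 : k = 1
    · subst hk1
      simp only [Nat.sub_self, Nat.zero_le, if_true, Nat.sub_zero] at h1
      omega
    · have e3 : (if k - 1 ≤ n then A.count (n - (k - 1)) else 0)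
          = if k - 1 ≤ n then B.count (n - (k - 1)) else 0 := by
        split_ifs
        · exact ih _ (by omega)
        · rfl
      rw [e3] at h1
      omega

lemma lift_def (A : Multiset ℕ) :
    (A >>= fun t => (pure (t : ℤ) : Multiset ℤ)) = A.map (fun t : ℕ => (t : ℤ)) := by
  show A.bind (fun t => {(t : ℤ)}) = _
  exact Multiset.bind_singleton _ _

lemma zsub_def (A : Multiset ℕ) (n : ℤ) : zsub A n = A.map (fun t : ℕ => (t : ℤ) - n) := by
  unfold zsub
  rw [lift_def, Multiset.map_map]
  rfl

lemma toZ_def (A : Multiset ℕ) : toZ A = A.map (fun t : ℕ => (t : ℤ)) := by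
  unfold toZ
  rw [lift_def, Multiset.map_map]
  rfl

lemma zsub_shift (A : Multiset ℕ) (d : ℕ) (m n : ℤ) (h : n = m + d) :
    zsub A m = zsub (A.map (· + d)) n := by
  rw [zsub_def, zsub_def, Multiset.map_map]
  refine Multiset.map_congr rfl fun t _ => ?_
  simp only [Function.comp, h]
  push_cast
  ring

lemma zsub_inj {A B : Multiset ℕ} {m : ℤ} (h : zsub A m = zsub B m) : A = B := by
  rw [zsub_def, zsub_def] at h
  refine Multiset.map_injective ?_ h
  intro x y hxy
  simpa using hxy

lemma zsub_eq {A B : Multiset ℕ} (d : ℕ) {m n : ℤ} (h : n = m + d) (he : zsub A m = zsub B n) :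
    B = A.map (· + d) := by
  rw [zsub_shift A d m n h] at he
  exact (zsub_inj he).symm

/-- Any admissible partition is determined. -/
lemma part_unique {k : ℕ} (hk : 1 ≤ k) (Q A B C D : Multiset ℕ)
    (hsum : A + B + C + D =
      Q.map (· + 4) + Q.map (· + 5) + Q.map (· + (k + 3)) + Q.map (· + (k + 4)))
    (h1 : zsub A 3 = zsub B 4) (h2 : zsub A 3 = zsub C (k + 2)) (h3 : zsub A 3 = zsub D (k + 3)) :
    A = Q.map (· + 4) ∧ B = Q.map (· + 5) ∧ C = Q.map (· + (k + 3)) ∧ D = Q.map (· + (k + 4)) := by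
  have hB := zsub_eq 1 (by norm_num) h1
  have hC := zsub_eq (k - 1) (by push_cast [hk]; ring) h2
  have hD := zsub_eq k (by ring) h3
  have s1 : Q.map (· + 5) = (Q.map (· + 4)).map (· + 1) := by
    rw [Multiset.map_map]; rfl
  have s2 : Q.map (· + (k + 3)) = (Q.map (· + 4)).map (· + (k - 1)) := by
    rw [Multiset.map_map]
    refine Multiset.map_congr rfl fun t _ => ?_
    simp only [Function.comp]; omega
  have s3 : Q.map (· + (k + 4)) = (Q.map (· + 4)).map (· + k) := by
    rw [Multiset.map_map]
    refine Multiset.map_congr rfl fun t _ => ?_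
    simp only [Function.comp]; omega
  have hA : A = Q.map (· + 4) := by
    refine shift_unique A _ ?_ hk
    rw [← hB, ← hC, ← hD, hsum, s1, s2, s3]
  refine ⟨hA, ?_, ?_, ?_⟩
  · rw [hB, hA, s1]
  · rw [hC, hA, s2]
  · rw [hD, hA, s3]

lemma part_exists {k : ℕ} (hk : 1 ≤ k) (Q M : Multiset ℕ)
    (hM : M = Q.map (· + 4) + Q.map (· + 5) + Q.map (· + (k + 3)) + Q.map (· + (k + 4))) :
    ∃! P : Multiset ℕ × Multiset ℕ × Multiset ℕ × Multiset ℕ,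
        P.1 + P.2.1 + P.2.2.1 + P.2.2.2 = M ∧
        Multiset.card P.1 = Multiset.card P.2.1 ∧
        Multiset.card P.1 = Multiset.card P.2.2.1 ∧
        Multiset.card P.1 = Multiset.card P.2.2.2 ∧
        zsub P.1 3 = zsub P.2.1 4 ∧
        zsub P.1 3 = zsub P.2.2.1 (k + 2) ∧
        zsub P.1 3 = zsub P.2.2.2 (k + 3) := by
  refine ⟨(Q.map (· + 4), Q.map (· + 5), Q.map (· + (k + 3)), Q.map (· + (k + 4))), ?_, ?_⟩
  · refine ⟨hM.symm, by simp, by simp, by simp, ?_, ?_, ?_⟩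
    all_goals
      simp only [zsub_def, Multiset.map_map]
      refine Multiset.map_congr rfl fun t _ => ?_
      simp only [Function.comp]
      push_cast
      ring
  · rintro ⟨A, B, C, D⟩ ⟨h0, -, -, -, h1, h2, h3⟩
    obtain ⟨rfl, rfl, rfl, rfl⟩ := part_unique hk Q A B C D (h0.trans hM) h1 h2 h3
    rfl

lemma dms_eq_plen (N : LabGraph X) (x y : X) : N.dms x y = plen N.G (N.leaf x) (N.leaf y) := by
  classical
  unfold dms plen
  rw [Finset.sum_eq_multiset_sum]
  have := Multiset.sum_map_singleton ((Finset.univ : Finset (N.G.Path (N.leaf x) (N.leaf y))).val.map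
    fun p => p.1.length)
  rw [Multiset.map_map] at this
  exact this.symm

section replace

variable {V : Type} {G : SimpleGraph V} {S : Set V} {u w : V}

/-- The graph obtained by replacing `S` by a single vertex attached to `w`. -/
def brG (G : SimpleGraph V) (S : Set V) (w : V) (hw : w ∉ S) :
    SimpleGraph ({v : V // v ∉ S} ⊕ Unit) :=
  SimpleGraph.fromRel (fun w₁ w₂ =>
    (∃ v₁ v₂ : {v : V // v ∉ S}, w₁ = Sum.inl v₁ ∧ w₂ = Sum.inl v₂ ∧ G.Adj v₁.1 v₂.1) ∨
    (w₁ = Sum.inl ⟨w, hw⟩ ∧ w₂ = Sum.inr ()))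

lemma br_ll (hw : w ∉ S) (v v' : {v : V // v ∉ S}) :
    (brG G S w hw).Adj (Sum.inl v) (Sum.inl v') ↔ G.Adj v.1 v'.1 := by
  unfold brG
  rw [SimpleGraph.fromRel_adj]
  constructor
  · rintro ⟨-, (⟨a, b, ha, hb, h⟩ | h) | (⟨a, b, ha, hb, h⟩ | h)⟩
    · cases ha; cases hb; exact h
    · cases h.2
    · cases ha; cases hb; exact h.symm
    · cases h.2
  · intro h
    refine ⟨fun he => h.ne ?_, Or.inl (Or.inl ⟨v, v', rfl, rfl, h⟩)⟩
    cases he; rfl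

lemma br_lr (hw : w ∉ S) (v : {v : V // v ∉ S}) :
    (brG G S w hw).Adj (Sum.inl v) (Sum.inr ()) ↔ v = ⟨w, hw⟩ := by
  unfold brG
  rw [SimpleGraph.fromRel_adj]
  constructor
  · rintro ⟨-, (⟨a, b, ha, hb, h⟩ | h) | (⟨a, b, ha, hb, h⟩ | h)⟩
    · cases hb
    · cases h.1; rfl
    · cases ha
    · cases h.1
  · rintro rfl
    exact ⟨by simp, Or.inl (Or.inr ⟨rfl, rfl⟩)⟩

lemma br_r (hw : w ∉ S) (v : {v : V // v ∉ S} ⊕ Unit) :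
    (brG G S w hw).Adj (Sum.inr ()) v ↔ v = Sum.inl ⟨w, hw⟩ := by
  rcases v with v | v
  · rw [SimpleGraph.adj_comm, br_lr]
    simp
  · constructor
    · intro h; exact absurd rfl h.ne
    · intro h; cases h

/-- The inclusion of the induced subgraph into the replaced graph. -/
def brEmb (hw : w ∉ S) (T : Set ({v : V // v ∉ S} ⊕ Unit)) (hT : T ⊆ {Sum.inr ()}) :
    G.induce Sᶜ ↪g vdel (brG G S w hw) T where
  toFun v := Sum.inl ⟨v.1, v.2⟩
  inj' := by
    intro a b h
    simpa [Subtype.ext_iff] using h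
  map_rel_iff' := by
    intro a b
    have hT' : ∀ v : {v : V // v ∉ S}, Sum.inl v ∉ T := fun v hv => by
      have := hT hv
      simp at this
    have h1 : ((brG G S w hw).Adj (Sum.inl ⟨a.1, a.2⟩) (Sum.inl ⟨b.1, b.2⟩) ∧
        Sum.inl ⟨a.1, a.2⟩ ∉ T ∧ Sum.inl ⟨b.1, b.2⟩ ∉ T) ↔ G.Adj a.1 b.1 := by
      rw [br_ll]
      exact ⟨fun h => h.1, fun h => ⟨h, hT' _, hT' _⟩⟩
    exact h1

lemma br_plen [Fintype V] [Fintype ({v : V // v ∉ S} ⊕ Unit)] (hw : w ∉ S)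
    (hS : ∀ a ∈ S, ∀ b, G.Adj a b → b ∉ S → a = u ∧ b = w)
    (T : Set ({v : V // v ∉ S} ⊕ Unit)) (hT : T ⊆ {Sum.inr ()}) (T' : Set V) (hT' : T' ⊆ S)
    (x y : {v : V // v ∉ S}) :
    plen (vdel (brG G S w hw) T) (Sum.inl x) (Sum.inl y) = plen (vdel G T') x.1 y.1 := by
  classical
  rw [plen_ind G S T' hT' u w hS x.1 y.1 x.2 y.2]
  refine plen_embed (brEmb (G := G) hw T hT) ⟨x.1, x.2⟩ ⟨y.1, y.2⟩ ?_
  intro p hp v hv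
  have := path_avoid (vdel (brG G S w hw) T) {Sum.inr ()} (Sum.inr ()) (Sum.inl ⟨w, hw⟩) (by
    rintro a rfl b hab -
    exact ⟨rfl, (br_r hw b).1 hab.1⟩) p hp (by simp [brEmb]) (by simp [brEmb]) v hv
  rcases v with v | v
  · exact ⟨⟨v.1, v.2⟩, rfl⟩
  · simp at this

lemma br_plen_z [Fintype V] [Fintype ({v : V // v ∉ S} ⊕ Unit)] (hw : w ∉ S)
    (hS : ∀ a ∈ S, ∀ b, G.Adj a b → b ∉ S → a = u ∧ b = w) (x : {v : V // v ∉ S}) :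
    plen (brG G S w hw) (Sum.inl x) (Sum.inr ()) = (plen (vdel G S) w x.1).map (· + 1) := by
  rw [plen_comm, plen_one _ (Sum.inr ()) (Sum.inl x) (Sum.inl ⟨w, hw⟩) (by simp)
    ((br_r hw _).2 rfl)]
  · rw [br_plen hw hS _ subset_rfl S subset_rfl]
  · intro m hm hne
    exact absurd ((br_r hw m).1 hm) hne

lemma br_conn (hw : w ∉ S) (hS : ∀ a ∈ S, ∀ b, G.Adj a b → b ∉ S → a = u ∧ b = w)
    (hG : G.Connected) : (brG G S w hw).Connected := by
  classical
  have key : ∀ (x y : V) (p : G.Walk x y) (_ : ∀ v ∈ p.support, v ∉ S) (hx : x ∉ S) (hy : y ∉ S),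
      (brG G S w hw).Reachable (Sum.inl ⟨x, hx⟩) (Sum.inl ⟨y, hy⟩) := by
    intro x y p
    induction p with
    | nil => intro _ _ _; exact Reachable.refl _
    | @cons a n b h q ih =>
      intro hsup hx hy
      have hn : n ∉ S := hsup n (by simp)
      have h1 : (brG G S w hw).Adj (Sum.inl ⟨a, hx⟩) (Sum.inl ⟨n, hn⟩) := (br_ll hw _ _).2 h
      exact h1.reachable.trans (ih (fun v hv => hsup v (by simp [hv])) hn hy)
  have hll : ∀ x y : {v : V // v ∉ S}, (brG G S w hw).Reachable (Sum.inl x) (Sum.inl y) := by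
    intro x y
    obtain ⟨p, hp⟩ := (hG.preconnected x.1 y.1).exists_isPath
    exact key _ _ p (path_avoid G S u w hS p hp x.2 y.2) x.2 y.2
  have hz : (brG G S w hw).Adj (Sum.inr ()) (Sum.inl ⟨w, hw⟩) := (br_r hw _).2 rfl
  have hall : ∀ x, (brG G S w hw).Reachable (Sum.inl ⟨w, hw⟩) x := by
    rintro (x | x)
    · exact hll _ _
    · exact hz.symm.reachable
  have : Nonempty ({v : V // v ∉ S} ⊕ Unit) := ⟨Sum.inr ()⟩
  exact ⟨fun x y => (hall x).symm.trans (hall y)⟩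

lemma br_deg (hw : w ∉ S) (hS : ∀ a ∈ S, ∀ b, G.Adj a b → b ∉ S → a = u ∧ b = w)
    (hu : u ∈ S) (huw : G.Adj u w) (v : {v : V // v ∉ S}) :
    ((brG G S w hw).neighborSet (Sum.inl v)).ncard = (G.neighborSet v.1).ncard := by
  classical
  let g : {v : V // v ∉ S} ⊕ Unit → V := Sum.elim Subtype.val (fun _ => u)
  have hg : Function.Injective g := by
    rintro (a | a) (b | b) h
    · exact congrArg Sum.inl (Subtype.ext h)
    · exact absurd (show a.1 ∈ S from (show a.1 = u from h) ▸ hu) a.2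
    · exact absurd (show b.1 ∈ S from (show u = b.1 from h) ▸ hu) b.2
    · rfl
  rw [← Set.ncard_image_of_injective _ hg]
  congr 1
  ext y
  constructor
  · rintro ⟨(a | a), ha, rfl⟩
    · exact (br_ll hw _ _).1 ha
    · have := (br_lr hw _).1 ha
      subst this
      exact huw.symm
  · intro hy
    by_cases hyS : y ∈ S
    · obtain ⟨h1, h2⟩ := hS y hyS v.1 (SimpleGraph.Adj.symm hy) v.2
      exact ⟨Sum.inr (), (br_lr hw v).2 (Subtype.ext h2), h1.symm⟩
    · exact ⟨Sum.inl ⟨y, hyS⟩, (br_ll hw _ _).2 hy, rfl⟩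

lemma br_deg_z (hw : w ∉ S) : ((brG G S w hw).neighborSet (Sum.inr ())).ncard = 1 := by
  rw [Set.ncard_eq_one]
  refine ⟨Sum.inl ⟨w, hw⟩, ?_⟩
  ext v
  exact br_r hw v

end replace

lemma br_network {N : LabGraph X} (hN : N.IsNetwork) {A : Set X} {S : Set N.V} {u w : N.V}
    [Fintype ({x : X // x ∉ A} ⊕ Unit)] (hmem : ∀ x : X, x ∉ A → N.leaf x ∉ S) (hw : w ∉ S)
    (hS : ∀ a ∈ S, ∀ b, N.G.Adj a b → b ∉ S → a = u ∧ b = w)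
    (hu : u ∈ S) (huw : N.G.Adj u w) (hA : N.leaf '' A ⊆ S) :
    (N.blobReplace A S w hmem hw).IsNetwork := by
  have hdeg : (∀ x : X, N.degOf (N.leaf x) = 1) ∧
        ∀ v : N.V, v ∉ Set.range N.leaf → N.degOf v = 3 := by
    obtain ⟨-, -, h | h⟩ := hN
    · have := Fintype.card_le_one_iff_subsingleton.1 h.2.le
      exact absurd (Subsingleton.elim u w) huw.ne
    · exact h
  refine ⟨br_conn hw hS hN.1, ?_, Or.inr ⟨?_, ?_⟩⟩
  · rintro (x | x) (y | y) h
    · have h' := congrArg Subtype.val (Sum.inl_injective h)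
      exact congrArg Sum.inl (Subtype.ext (hN.2.1 h'))
    · cases h
    · cases h
    · rfl
  · rintro (x | x)
    · exact (br_deg hw hS hu huw ⟨N.leaf x.1, hmem x.1 x.2⟩).trans (hdeg.1 x.1)
    · exact br_deg_z hw
  · rintro (v | v) hv
    · refine (br_deg hw hS hu huw v).trans (hdeg.2 v.1 ?_)
      rintro ⟨x, hx⟩
      by_cases hxA : x ∈ A
      · exact v.2 (hx ▸ hA ⟨x, hxA, rfl⟩)
      · exact hv ⟨Sum.inl ⟨x, hxA⟩, congrArg Sum.inl (Subtype.ext hx)⟩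
    · exact absurd ⟨Sum.inr (), rfl⟩ hv

/-- Lemma 8 (pendant level-2 blob `(k,0,0,0)` reduction): let `H` be a pendant
level-2 blob of the form `(k, 0, 0, 0)` (`k ≥ 1`) with chain `(a_1, ..., a_k)` and
non-trivial cut-edge `uw` (`u ∈ H`), in a level-2 network with at least two blobs and
all leaves in blobs.  For every leaf `x` off the chain, `d(x, a_1)` has a unique
partition into four equal-sized multisets `A, B, C, D` with
`A - 3 = B - 4 = C - (k+2) = D - (k+3)`; replacing the pendant blob by a new leaf `z`
(attached to `w`) yields a network `N'` whose multisets of distances are unchanged off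
the chain and satisfy `d^{N'}(x, z) = A - 3`. -/
theorem pendant_level2_blob_k000_reduction
    (X : Type) [Fintype X] [DecidableEq X]
    (N : LabGraph X) (hN : N.IsNetwork) (hlev : N.IsLevel 2)
    (hblobs : N.TwoBlobs) (hleaves : N.AllLeavesInBlobs)
    (k : ℕ) (hk : 1 ≤ k) (a : Fin k → X)
    (H : N.G.Subgraph) (u w : N.V)
    (hform : N.IsFormBlob H u w k 0 0 0 a Fin.elim0 Fin.elim0 Fin.elim0)
    (hmem : ∀ x : X, x ∉ Set.range a → N.leaf x ∉ H.verts ∪ N.leaf '' Set.range a)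
    (hw' : w ∉ H.verts ∪ N.leaf '' Set.range a) :
    (∀ x : X, x ∉ Set.range a →
      ∃! Q : Multiset ℕ × Multiset ℕ × Multiset ℕ × Multiset ℕ,
        Q.1 + Q.2.1 + Q.2.2.1 + Q.2.2.2 = N.dms x (a ⟨0, by omega⟩) ∧
        Multiset.card Q.1 = Multiset.card Q.2.1 ∧
        Multiset.card Q.1 = Multiset.card Q.2.2.1 ∧
        Multiset.card Q.1 = Multiset.card Q.2.2.2 ∧
        zsub Q.1 3 = zsub Q.2.1 4 ∧
        zsub Q.1 3 = zsub Q.2.2.1 (k + 2) ∧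
        zsub Q.1 3 = zsub Q.2.2.2 (k + 3)) ∧
    ∀ N' : LabGraph ({x : X // x ∉ Set.range a} ⊕ Unit),
      N' = N.blobReplace (Set.range a) (H.verts ∪ N.leaf '' Set.range a) w hmem hw' →
      (N'.IsNetwork ∧
        (∀ (x y : X) (hx : x ∉ Set.range a) (hy : y ∉ Set.range a),
          N'.dms (Sum.inl ⟨x, hx⟩) (Sum.inl ⟨y, hy⟩) = N.dms x y) ∧
        (∀ (x : X) (hx : x ∉ Set.range a) (A B C D : Multiset ℕ),
          A + B + C + D = N.dms x (a ⟨0, by omega⟩) →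
          Multiset.card A = Multiset.card B →
          Multiset.card A = Multiset.card C →
          Multiset.card A = Multiset.card D →
          zsub A 3 = zsub B 4 →
          zsub A 3 = zsub C (k + 2) →
          zsub A 3 = zsub D (k + 3) →
          toZ (N'.dms (Sum.inl ⟨x, hx⟩) (Sum.inr ())) = zsub A 3)) := by
  obtain ⟨c, l, hT, hl⟩ := theta_of_form hN hk hform
  have hS := hT.bdry
  have hu := hT.uS
  have huw : N.G.Adj u w := hform.2.2.1.1
  have hd : ∀ x : X, x ∉ Set.range a → N.dms x (a ⟨0, by omega⟩) =
      (plen (vdel N.G (H.verts ∪ N.leaf '' Set.range a)) w (N.leaf x)).map (· + 4) +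
      (plen (vdel N.G (H.verts ∪ N.leaf '' Set.range a)) w (N.leaf x)).map (· + 5) +
      (plen (vdel N.G (H.verts ∪ N.leaf '' Set.range a)) w (N.leaf x)).map (· + (k + 3)) +
      (plen (vdel N.G (H.verts ∪ N.leaf '' Set.range a)) w (N.leaf x)).map (· + (k + 4)) := by
    intro x hx
    rw [dms_eq_plen, plen_comm, ← hl]
    exact hT.total (N.leaf x) (hmem x hx)
  refine ⟨fun x hx => part_exists hk _ _ (hd x hx), ?_⟩
  rintro N' rfl
  refine ⟨br_network hN hmem hw' hS hu huw Set.subset_union_right, ?_, ?_⟩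
  · intro x y hx hy
    rw [dms_eq_plen, dms_eq_plen]
    have := @br_plen N.V N.G _ u w N.fV (LabGraph.fV (N.blobReplace _ _ w hmem hw')) hw' hS ∅
      (Set.empty_subset _) ∅ (Set.empty_subset _) ⟨N.leaf x, hmem x hx⟩ ⟨N.leaf y, hmem y hy⟩
    rw [vdel_empty, vdel_empty] at this
    exact this
  · intro x hx A B C D hsum _ _ _ h1 h2 h3
    obtain ⟨hA, -, -, -⟩ := part_unique hk _ A B C D (hsum.trans (hd x hx)) h1 h2 h3
    have := @br_plen_z N.V N.G _ u w N.fV (LabGraph.fV (N.blobReplace _ _ w hmem hw')) hw' hS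
      ⟨N.leaf x, hmem x hx⟩
    rw [dms_eq_plen]
    refine (congrArg toZ this).trans ?_
    rw [hA, toZ_def, zsub_def, Multiset.map_map, Multiset.map_map]
    refine Multiset.map_congr rfl fun t _ => ?_
    simp only [Function.comp]
    push_cast
    ring

end LabGraph
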